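/- Let d ≥ 3, 1 ≤ p < d/2, and let μ be a probability measure on ℝ^d with finite q-th moment for some q > dp/(d−p), such that the density f of the absolutely continuous part of μ is Riemann integrable on every cube. Then limsup_{N→∞} N^{1/d} E[ρ_p^p(μ, μ̂_N)]^{1/p} ≤ κ_p^unif · (∫_{ℝ^d} f(x)^{1−p/d} dx)^{1/p}, where κ_p^unif = lim_{N→∞} N^{1/d} E[ρ_p^p(U, Û_N)]^{1/p} ∈ (0,∞) is the limit constant for the uniform distribution U on [0,1)^d. -/

import Mathlib

open MeasureTheory ENNReal

/-- The set of couplings (transports) between two measures on `ℝ^d`. -/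
def couplings {d : ℕ} (μ ν : Measure (Fin d → ℝ)) :
    Set (Measure ((Fin d → ℝ) × (Fin d → ℝ))) :=
  {ξ | ξ.map Prod.fst = μ ∧ ξ.map Prod.snd = ν}

/-- `ρ_p^p(μ,ν)`: the `p`-th power of the `p`-th Wasserstein metric. -/
noncomputable def WpPow {d : ℕ} (p : ℝ) (μ ν : Measure (Fin d → ℝ)) : ℝ≥0∞ :=
  ⨅ ξ ∈ couplings μ ν, ∫⁻ z, (‖z.1 - z.2‖₊ : ℝ≥0∞) ^ p ∂ξ

/-- The empirical measure `(1/N) ∑_{j<N} δ_{x_j}` of a vector of `N` points. -/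
noncomputable def empMeas {d : ℕ} (N : ℕ) (x : Fin N → (Fin d → ℝ)) :
    Measure (Fin d → ℝ) :=
  (N : ℝ≥0∞)⁻¹ • ∑ j, Measure.dirac (x j)

/-- `E[ρ_p^p(μ, μ̂_N)]`: the expected `p`-th power Wasserstein distance between `μ`
and the empirical measure of `N` i.i.d. `μ`-distributed samples (modelled on the
canonical product space). -/
noncomputable def expWpPow {d : ℕ} (p : ℝ) (μ : Measure (Fin d → ℝ)) (N : ℕ) :
    ℝ≥0∞ :=
  ∫⁻ x, WpPow p μ (empMeas N x) ∂(Measure.pi fun _ : Fin N => μ)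

/-- The unit cube `[0,1)^d`. -/
def unitBox (d : ℕ) : Set (Fin d → ℝ) := Set.univ.pi fun _ => Set.Ico (0 : ℝ) 1

/-- A set is an axis-parallel half-open box. -/
def IsBox {d : ℕ} (B : Set (Fin d → ℝ)) : Prop :=
  ∃ a b : Fin d → ℝ, B = Set.univ.pi fun i => Set.Ico (a i) (b i)

/-- A step function: a finite linear combination of indicators of boxes. -/
def IsStepFun {d : ℕ} (g : (Fin d → ℝ) → ℝ) : Prop :=
  ∃ (n : ℕ) (c : Fin n → ℝ) (B : Fin n → Set (Fin d → ℝ)),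
    (∀ i, IsBox (B i)) ∧ g = fun x => ∑ i, c i * (B i).indicator 1 x

/-- `f` is Riemann integrable on every cube (Darboux criterion): on each box it can
be squeezed between step functions whose integrals differ by less than any `ε`. -/
def RiemannIntegrableOnCubes {d : ℕ} (f : (Fin d → ℝ) → ℝ) : Prop :=
  ∀ B : Set (Fin d → ℝ), IsBox B → ∀ ε : ℝ, 0 < ε →
    ∃ g h : (Fin d → ℝ) → ℝ, IsStepFun g ∧ IsStepFun h ∧
      (∀ x ∈ B, g x ≤ f x ∧ f x ≤ h x) ∧ (∫ x in B, (h x - g x)) < ε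

/-- The `p`-th absolute moment of a measure. -/
noncomputable def pMoment {d : ℕ} (p : ℝ) (μ : Measure (Fin d → ℝ)) : ℝ≥0∞ :=
  ∫⁻ x, (‖x‖₊ : ℝ≥0∞) ^ p ∂μ

lemma measurable_cost {d : ℕ} (p : ℝ) :
    Measurable fun z : (Fin d → ℝ) × (Fin d → ℝ) => (‖z.1 - z.2‖₊ : ℝ≥0∞) ^ p := by
  fun_prop

lemma measurable_nnnorm_rpow {d : ℕ} (p : ℝ) :
    Measurable fun x : Fin d → ℝ => (‖x‖₊ : ℝ≥0∞) ^ p := by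
  fun_prop

lemma WpPow_le_of_mem {d : ℕ} {p : ℝ} {μ ν : Measure (Fin d → ℝ)}
    {ξ : Measure ((Fin d → ℝ) × (Fin d → ℝ))} (h : ξ ∈ couplings μ ν) :
    WpPow p μ ν ≤ ∫⁻ z, (‖z.1 - z.2‖₊ : ℝ≥0∞) ^ p ∂ξ :=
  iInf₂_le ξ h

lemma exists_coupling_lt {d : ℕ} {p : ℝ} {μ ν : Measure (Fin d → ℝ)} {c : ℝ≥0∞}
    (h : WpPow p μ ν < c) :
    ∃ ξ ∈ couplings μ ν, ∫⁻ z, (‖z.1 - z.2‖₊ : ℝ≥0∞) ^ p ∂ξ < c := by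
  simpa [WpPow, iInf_lt_iff] using h

lemma couplings_add {d : ℕ} {μ₁ μ₂ ν₁ ν₂ : Measure (Fin d → ℝ)}
    {ξ₁ ξ₂ : Measure ((Fin d → ℝ) × (Fin d → ℝ))}
    (h₁ : ξ₁ ∈ couplings μ₁ ν₁) (h₂ : ξ₂ ∈ couplings μ₂ ν₂) :
    ξ₁ + ξ₂ ∈ couplings (μ₁ + μ₂) (ν₁ + ν₂) := by
  refine ⟨?_, ?_⟩
  · rw [Measure.map_add _ _ measurable_fst, h₁.1, h₂.1]
  · rw [Measure.map_add _ _ measurable_snd, h₁.2, h₂.2]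

lemma WpPow_add_le {d : ℕ} {p : ℝ} (μ₁ μ₂ ν₁ ν₂ : Measure (Fin d → ℝ)) :
    WpPow p (μ₁ + μ₂) (ν₁ + ν₂) ≤ WpPow p μ₁ ν₁ + WpPow p μ₂ ν₂ := by
  unfold WpPow
  simp only [iInf_subtype', ENNReal.iInf_add, ENNReal.add_iInf]
  refine le_iInf fun ξ₂ => le_iInf fun ξ₁ => ?_
  refine (iInf_le _ ⟨ξ₁.1 + ξ₂.1, couplings_add ξ₁.2 ξ₂.2⟩).trans ?_
  simp [lintegral_add_measure]

lemma WpPow_smul_le {d : ℕ} {p : ℝ} (c : ℝ≥0∞) (hc : c ≠ ∞) (μ ν : Measure (Fin d → ℝ)) :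
    WpPow p (c • μ) (c • ν) ≤ c * WpPow p μ ν := by
  rcases eq_or_ne c 0 with rfl | hc0
  · refine (WpPow_le_of_mem (ξ := 0) ?_).trans (by simp)
    constructor <;> simp
  · rw [WpPow, WpPow]
    simp only [iInf_subtype', ENNReal.mul_iInf_of_ne hc0 hc]
    refine le_iInf fun ξ => ?_
    have hm : c • ξ.1 ∈ couplings (c • μ) (c • ν) :=
      ⟨by rw [Measure.map_smul, ξ.2.1], by rw [Measure.map_smul, ξ.2.2]⟩
    exact (iInf_le _ ⟨c • ξ.1, hm⟩).trans (by simp)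

lemma smul_prod_mem_couplings {d : ℕ} {μ ν : Measure (Fin d → ℝ)}
    [IsFiniteMeasure μ] [IsFiniteMeasure ν] (h : μ Set.univ = ν Set.univ) :
    (μ Set.univ)⁻¹ • μ.prod ν ∈ couplings μ ν := by
  rcases eq_or_ne (μ Set.univ) 0 with h0 | h0
  · have h1 : μ = 0 := Measure.measure_univ_eq_zero.1 h0
    have h2 : ν = 0 := Measure.measure_univ_eq_zero.1 (h ▸ h0)
    subst h1 h2
    constructor <;> simp
  · constructor
    · rw [Measure.map_smul, Measure.map_fst_prod, smul_smul, ← h,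
        ENNReal.inv_mul_cancel h0 (measure_ne_top _ _), one_smul]
    · rw [Measure.map_smul, Measure.map_snd_prod, smul_smul,
        ENNReal.inv_mul_cancel h0 (measure_ne_top _ _), one_smul]

lemma WpPow_le_pMoment {d : ℕ} {p : ℝ} (hp : 1 ≤ p) {μ ν : Measure (Fin d → ℝ)}
    [IsFiniteMeasure μ] [IsFiniteMeasure ν] (h : μ Set.univ = ν Set.univ) :
    WpPow p μ ν ≤ 2 ^ p * (pMoment p μ + pMoment p ν) := by
  have hξ := smul_prod_mem_couplings h
  set ξ := (μ Set.univ)⁻¹ • μ.prod ν with hξdef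
  calc WpPow p μ ν ≤ ∫⁻ z, (‖z.1 - z.2‖₊ : ℝ≥0∞) ^ p ∂ξ := WpPow_le_of_mem hξ
    _ ≤ ∫⁻ z, 2 ^ p * ((‖z.1‖₊ : ℝ≥0∞) ^ p + (‖z.2‖₊ : ℝ≥0∞) ^ p) ∂ξ := by
        refine lintegral_mono fun z => ?_
        have h1 : (‖z.1 - z.2‖₊ : ℝ≥0∞) ≤ ‖z.1‖₊ + ‖z.2‖₊ := by
          exact_mod_cast nnnorm_sub_le z.1 z.2
        calc (‖z.1 - z.2‖₊ : ℝ≥0∞) ^ p ≤ (‖z.1‖₊ + ‖z.2‖₊ : ℝ≥0∞) ^ p := by gcongr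
          _ ≤ 2 ^ (p - 1) * ((‖z.1‖₊ : ℝ≥0∞) ^ p + (‖z.2‖₊ : ℝ≥0∞) ^ p) :=
              ENNReal.rpow_add_le_mul_rpow_add_rpow _ _ hp
          _ ≤ _ := by
              gcongr
              · norm_num
              · linarith
    _ = 2 ^ p * (∫⁻ x, (‖x‖₊ : ℝ≥0∞) ^ p ∂(ξ.map Prod.fst)
          + ∫⁻ x, (‖x‖₊ : ℝ≥0∞) ^ p ∂(ξ.map Prod.snd)) := by
        rw [lintegral_const_mul _ (by fun_prop), lintegral_add_left (by fun_prop),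
          lintegral_map (by fun_prop) measurable_fst, lintegral_map (by fun_prop) measurable_snd]
    _ = _ := by rw [hξ.1, hξ.2]; rfl

lemma WpPow_sum_le {d : ℕ} {p : ℝ} {ι : Type*} [Countable ι]
    (μ ν : ι → Measure (Fin d → ℝ)) [∀ i, IsFiniteMeasure (μ i)] [∀ i, IsFiniteMeasure (ν i)]
    (h : ∀ i, μ i Set.univ = ν i Set.univ) (D : ι → ℝ≥0∞) (S : ι → Set (Fin d → ℝ))
    (hμ : ∀ i, ∀ᵐ x ∂μ i, x ∈ S i) (hν : ∀ i, ∀ᵐ x ∂ν i, x ∈ S i)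
    (hD : ∀ i, ∀ x ∈ S i, ∀ y ∈ S i, (‖x - y‖₊ : ℝ≥0∞) ^ p ≤ D i) :
    WpPow p (Measure.sum μ) (Measure.sum ν) ≤ ∑' i, D i * μ i Set.univ := by
  have hξ := fun i => smul_prod_mem_couplings (h i)
  refine (WpPow_le_of_mem (ξ := Measure.sum fun i => (μ i Set.univ)⁻¹ • (μ i).prod (ν i))
    ⟨?_, ?_⟩).trans ?_
  · rw [Measure.map_sum measurable_fst.aemeasurable]
    congr 1; ext1 i; exact (hξ i).1
  · rw [Measure.map_sum measurable_snd.aemeasurable]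
    congr 1; ext1 i; exact (hξ i).2
  · rw [lintegral_sum_measure]
    refine ENNReal.tsum_le_tsum fun i => ?_
    set ξ := (μ i Set.univ)⁻¹ • (μ i).prod (ν i) with hξi
    have h1 : ∀ᵐ z ∂ξ, z.1 ∈ S i := by
      refine ae_of_ae_map measurable_fst.aemeasurable (p := fun x => x ∈ S i) ?_
      rw [(hξ i).1]; exact hμ i
    have h2 : ∀ᵐ z ∂ξ, z.2 ∈ S i := by
      refine ae_of_ae_map measurable_snd.aemeasurable (p := fun x => x ∈ S i) ?_
      rw [(hξ i).2]; exact hν i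
    calc ∫⁻ z, (‖z.1 - z.2‖₊ : ℝ≥0∞) ^ p ∂ξ ≤ ∫⁻ z, D i ∂ξ := by
          refine lintegral_mono_ae ?_
          filter_upwards [h1, h2] with z hz1 hz2 using hD i _ hz1 _ hz2
      _ = D i * μ i Set.univ := by
          rw [lintegral_const]
          congr 1
          conv_rhs => rw [← (hξ i).1, Measure.map_apply measurable_fst MeasurableSet.univ]
          rw [Set.preimage_univ, hξi]

lemma WpPow_map_le {d : ℕ} {p : ℝ} (hp : 0 ≤ p) (a : Fin d → ℝ) {s : ℝ} (hs : 0 < s)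
    (μ ν : Measure (Fin d → ℝ)) :
    WpPow p (μ.map fun x => a + s • x) (ν.map fun x => a + s • x)
      ≤ ENNReal.ofReal s ^ p * WpPow p μ ν := by
  rw [WpPow, WpPow]
  have hne : ENNReal.ofReal s ^ p ≠ ∞ := ENNReal.rpow_ne_top_of_nonneg hp ENNReal.ofReal_ne_top
  have hne0 : ENNReal.ofReal s ^ p ≠ 0 := by
    simp [ENNReal.rpow_eq_zero_iff, hs.not_ge]
  have hT : Measurable fun x : Fin d → ℝ => a + s • x := by fun_prop
  have hTT : Measurable fun z : (Fin d → ℝ) × (Fin d → ℝ) => (a + s • z.1, a + s • z.2) := by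
    fun_prop
  simp only [iInf_subtype', ENNReal.mul_iInf_of_ne hne0 hne]
  refine le_iInf fun ⟨ξ, hξ⟩ => ?_
  have hm : ξ.map (fun z => (a + s • z.1, a + s • z.2)) ∈
      couplings (μ.map fun x => a + s • x) (ν.map fun x => a + s • x) := by
    constructor
    · rw [Measure.map_map measurable_fst hTT, ← hξ.1, Measure.map_map hT measurable_fst]
      rfl
    · rw [Measure.map_map measurable_snd hTT, ← hξ.2, Measure.map_map hT measurable_snd]
      rfl
  refine (iInf_le _ ⟨_, hm⟩).trans ?_
  rw [lintegral_map (measurable_cost p) hTT, ← lintegral_const_mul _ (measurable_cost p)]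
  refine lintegral_mono fun z => le_of_eq ?_
  dsimp only
  rw [← ENNReal.mul_rpow_of_nonneg _ _ hp, add_sub_add_left_eq_sub, ← smul_sub, nnnorm_smul,
    ENNReal.coe_mul]
  congr 2
  rw [← enorm_eq_nnnorm, Real.enorm_eq_ofReal hs.le]

lemma empMeas_apply {d N : ℕ} (x : Fin N → Fin d → ℝ) {s : Set (Fin d → ℝ)}
    (hs : MeasurableSet s) :
    empMeas N x s = (N : ℝ≥0∞)⁻¹ * ∑ j, s.indicator 1 (x j) := by
  simp [empMeas, Measure.finsetSum_apply, Measure.dirac_apply' _ hs]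

lemma lintegral_empMeas {d N : ℕ} (x : Fin N → Fin d → ℝ) {g : (Fin d → ℝ) → ℝ≥0∞}
    (hg : Measurable g) :
    ∫⁻ y, g y ∂(empMeas N x) = (N : ℝ≥0∞)⁻¹ * ∑ j, g (x j) := by
  simp [empMeas, lintegral_dirac' _ hg]

lemma empMeas_univ {d N : ℕ} (hN : N ≠ 0) (x : Fin N → Fin d → ℝ) :
    empMeas N x Set.univ = 1 := by
  rw [empMeas_apply x MeasurableSet.univ]
  simp [ENNReal.inv_mul_cancel (Nat.cast_ne_zero.2 hN) (natCast_ne_top N)]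

lemma isProbabilityMeasure_empMeas {d N : ℕ} (hN : N ≠ 0) (x : Fin N → Fin d → ℝ) :
    IsProbabilityMeasure (empMeas N x) := ⟨empMeas_univ hN x⟩

lemma mem_couplings_of_allocation {d N : ℕ} {μ : Measure (Fin d → ℝ)}
    {ν : Fin N → Measure (Fin d → ℝ)} (hsum : ∑ j, ν j = μ)
    (hmass : ∀ j, ν j Set.univ = (N : ℝ≥0∞)⁻¹) (y : Fin N → Fin d → ℝ) :
    ∑ j, (ν j).map (fun u => (u, y j)) ∈ couplings μ (empMeas N y) := by
  have hm : ∀ j, Measurable fun u : Fin d → ℝ => (u, y j) := fun j => by fun_prop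
  constructor
  · rw [← Measure.mapₗ_apply_of_measurable measurable_fst, map_sum]
    simp_rw [Measure.mapₗ_apply_of_measurable measurable_fst, Measure.map_map measurable_fst (hm _)]
    rw [← hsum]
    exact Finset.sum_congr rfl fun j _ => Measure.map_id
  · rw [← Measure.mapₗ_apply_of_measurable measurable_snd, map_sum, empMeas, Finset.smul_sum]
    simp_rw [Measure.mapₗ_apply_of_measurable measurable_snd, Measure.map_map measurable_snd (hm _)]
    refine Finset.sum_congr rfl fun j _ => ?_
    have : (Prod.snd ∘ fun u : Fin d → ℝ => (u, y j)) = fun _ => y j := rfl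
    rw [this, Measure.map_const, hmass]

lemma WpPow_le_of_allocation {d N : ℕ} {p : ℝ} {μ : Measure (Fin d → ℝ)}
    {ν : Fin N → Measure (Fin d → ℝ)} (hsum : ∑ j, ν j = μ)
    (hmass : ∀ j, ν j Set.univ = (N : ℝ≥0∞)⁻¹) (y : Fin N → Fin d → ℝ) :
    WpPow p μ (empMeas N y) ≤ ∑ j, ∫⁻ u, (‖u - y j‖₊ : ℝ≥0∞) ^ p ∂ν j := by
  refine (WpPow_le_of_mem (mem_couplings_of_allocation hsum hmass y)).trans (le_of_eq ?_)
  rw [lintegral_finsetSum_measure]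
  exact Finset.sum_congr rfl fun j _ => lintegral_map (measurable_cost p) (by fun_prop)

lemma exists_allocation {d N : ℕ} {p : ℝ} {μ : Measure (Fin d → ℝ)}
    {x : Fin N → Fin d → ℝ}
    {ξ : Measure ((Fin d → ℝ) × (Fin d → ℝ))} (hξ : ξ ∈ couplings μ (empMeas N x)) :
    ∃ ν : Fin N → Measure (Fin d → ℝ), ∑ j, ν j = μ ∧
      (∀ j, ν j Set.univ = (N : ℝ≥0∞)⁻¹) ∧
      ∑ j, ∫⁻ u, (‖u - x j‖₊ : ℝ≥0∞) ^ p ∂ν j = ∫⁻ z, (‖z.1 - z.2‖₊ : ℝ≥0∞) ^ p ∂ξ := by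
  classical
  let n : (Fin d → ℝ) → ℕ := fun t => (Finset.univ.filter fun j => x j = t).card
  have hn : ∀ j, n (x j) ≠ 0 := fun j => Finset.card_ne_zero.2 ⟨j, by simp⟩
  let A : (Fin d → ℝ) → Set ((Fin d → ℝ) × (Fin d → ℝ)) := fun t => Prod.snd ⁻¹' {t}
  have hA : ∀ t, MeasurableSet (A t) := fun t => measurable_snd (measurableSet_singleton t)
  let η : (Fin d → ℝ) → Measure ((Fin d → ℝ) × (Fin d → ℝ)) :=
    fun t => (n t : ℝ≥0∞)⁻¹ • ξ.restrict (A t)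
  have hcancel : ∀ j, (n (x j) : ℝ≥0∞) * (n (x j) : ℝ≥0∞)⁻¹ = 1 := fun j =>
    ENNReal.mul_inv_cancel (Nat.cast_ne_zero.2 (hn j)) (natCast_ne_top _)
  have hsum : ∑ j, η (x j) = ξ := by
    rw [Finset.sum_comp η x]
    have h1 : ∀ t ∈ Finset.univ.image x,
        (Finset.univ.filter fun j => x j = t).card • η t = ξ.restrict (A t) := by
      intro t ht
      obtain ⟨j, -, rfl⟩ := Finset.mem_image.1 ht
      change n (x j) • ((n (x j) : ℝ≥0∞)⁻¹ • _) = _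
      rw [← Nat.cast_smul_eq_nsmul ℝ≥0∞, smul_smul, hcancel, one_smul]
    rw [Finset.sum_congr rfl h1]
    have h2 : ∑ t ∈ Finset.univ.image x, ξ.restrict (A t)
        = ξ.restrict (⋃ t ∈ Finset.univ.image x, A t) := by
      have hdisj : (↑(Finset.univ.image x) : Set (Fin d → ℝ)).Pairwise (Function.onFun Disjoint A) :=
        fun t _ t' _ h => Set.disjoint_left.2 fun z hz hz' => h (hz.symm.trans hz')
      rw [Measure.restrict_biUnion_finset hdisj hA, Measure.sum_fintype,
        Finset.sum_coe_sort (Finset.univ.image x) fun t => ξ.restrict (A t)]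
    rw [h2]
    refine Measure.restrict_eq_self_of_ae_mem ?_
    have : ∀ᵐ z ∂ξ, z.2 ∈ Set.range x := by
      refine ae_of_ae_map measurable_snd.aemeasurable (p := fun u => u ∈ Set.range x) ?_
      rw [hξ.2, ae_iff]
      have hr : MeasurableSet (Set.range x) := (Set.finite_range x).measurableSet
      change empMeas N x (Set.range x)ᶜ = 0
      rw [empMeas_apply x hr.compl]
      simp
    filter_upwards [this] with z hz
    obtain ⟨j, hj⟩ := hz
    simp only [Set.mem_iUnion]
    exact ⟨x j, by simp, hj.symm⟩
  refine ⟨fun j => (η (x j)).map Prod.fst, ?_, fun j => ?_, ?_⟩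
  · simp_rw [← Measure.mapₗ_apply_of_measurable measurable_fst]
    rw [← map_sum, hsum, Measure.mapₗ_apply_of_measurable measurable_fst, hξ.1]
  · rw [Measure.map_apply measurable_fst MeasurableSet.univ]
    have h3 : ξ (A (x j)) = (N : ℝ≥0∞)⁻¹ * n (x j) := by
      rw [← Measure.map_apply measurable_snd (measurableSet_singleton _), hξ.2,
        empMeas_apply x (measurableSet_singleton _)]
      simp [n, Set.indicator_apply]
    simp only [η, Set.preimage_univ, Measure.smul_apply, Measure.restrict_apply_univ, smul_eq_mul]
    rw [h3, mul_left_comm, mul_comm (n (x j) : ℝ≥0∞)⁻¹, hcancel, mul_one]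
  · conv_rhs => rw [← hsum]
    rw [lintegral_finsetSum_measure]
    refine Finset.sum_congr rfl fun j _ => ?_
    rw [lintegral_map (by fun_prop) measurable_fst]
    simp only [η, lintegral_smul_measure]
    congr 1
    refine setLIntegral_congr_fun (hA _) fun z hz => ?_
    have : z.2 = x j := hz
    simp [this]

lemma continuous_lintegral_sub_rpow {d : ℕ} {p : ℝ} (hp : 1 ≤ p) (ν : Measure (Fin d → ℝ))
    [IsFiniteMeasure ν] (hν : pMoment p ν ≠ ∞) :
    Continuous fun t => ∫⁻ u, (‖u - t‖₊ : ℝ≥0∞) ^ p ∂ν := by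
  refine continuous_iff_continuousAt.2 fun t₀ => ?_
  refine tendsto_lintegral_filter_of_dominated_convergence
    (fun u => 2 ^ p * ((‖u‖₊ : ℝ≥0∞) ^ p + (‖t₀‖₊ + 1 : ℝ≥0∞) ^ p)) ?_ ?_ ?_ ?_
  · exact Filter.Eventually.of_forall fun t => by fun_prop
  · filter_upwards [Metric.ball_mem_nhds t₀ one_pos] with t ht
    refine Filter.Eventually.of_forall fun u => ?_
    have h0 : ‖t‖₊ ≤ ‖t₀‖₊ + 1 := by
      have h : ‖t - t₀‖ < 1 := by simpa [dist_eq_norm] using ht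
      have : ‖t‖ ≤ ‖t₀‖ + ‖t - t₀‖ := by simpa using norm_add_le t₀ (t - t₀)
      rw [← NNReal.coe_le_coe]; push_cast; linarith
    have h1 : (‖u - t‖₊ : ℝ≥0∞) ≤ ‖u‖₊ + (‖t₀‖₊ + 1) := by
      exact_mod_cast (nnnorm_sub_le u t).trans (by gcongr)
    calc (‖u - t‖₊ : ℝ≥0∞) ^ p ≤ (‖u‖₊ + (‖t₀‖₊ + 1) : ℝ≥0∞) ^ p := by gcongr
      _ ≤ 2 ^ (p - 1) * ((‖u‖₊ : ℝ≥0∞) ^ p + (‖t₀‖₊ + 1 : ℝ≥0∞) ^ p) :=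
          ENNReal.rpow_add_le_mul_rpow_add_rpow _ _ hp
      _ ≤ _ := by
          gcongr
          · norm_num
          · linarith
  · have hp0 : 0 ≤ p := by linarith
    rw [lintegral_const_mul _ (by fun_prop), lintegral_add_left (by fun_prop), lintegral_const]
    refine ENNReal.mul_ne_top (ENNReal.rpow_ne_top_of_nonneg hp0 (by simp)) ?_
    refine ENNReal.add_ne_top.2 ⟨hν, ENNReal.mul_ne_top
      (ENNReal.rpow_ne_top_of_nonneg hp0 (by simp)) (measure_ne_top _ _)⟩
  · refine Filter.Eventually.of_forall fun u => ?_
    have : Continuous fun t : Fin d → ℝ => (‖u - t‖₊ : ℝ≥0∞) ^ p := by fun_prop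
    exact this.continuousAt

lemma upperSemicontinuous_WpPow_empMeas {d N : ℕ} {p : ℝ} (hp : 1 ≤ p)
    (μ : Measure (Fin d → ℝ)) [IsFiniteMeasure μ] (hμ : pMoment p μ ≠ ∞) :
    UpperSemicontinuous fun x : Fin N → Fin d → ℝ => WpPow p μ (empMeas N x) := by
  intro x c hc
  obtain ⟨ξ, hξ, hξc⟩ := exists_coupling_lt hc
  obtain ⟨ν, hsum, hmass, hcost⟩ := exists_allocation (p := p) hξ
  have hle : ∀ j, ν j ≤ μ := fun j => by
    rw [← hsum]
    refine Measure.le_iff.2 fun s _ => ?_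
    rw [Measure.finsetSum_apply]
    exact Finset.single_le_sum (f := fun j => ν j s) (fun _ _ => zero_le) (Finset.mem_univ j)
  have hfin : ∀ j, IsFiniteMeasure (ν j) := fun j => isFiniteMeasure_of_le μ (hle j)
  have hcont : Continuous fun y : Fin N → Fin d → ℝ =>
      ∑ j, ∫⁻ u, (‖u - y j‖₊ : ℝ≥0∞) ^ p ∂ν j := by
    refine continuous_finsetSum _ fun j _ => ?_
    have h := continuous_lintegral_sub_rpow hp (ν j)
      (ne_top_of_le_ne_top hμ (lintegral_mono' (hle j) le_rfl))
    exact h.comp (continuous_apply j)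
  rw [← hcost] at hξc
  filter_upwards [hcont.continuousAt.eventually_lt_const hξc] with y hy
  exact (WpPow_le_of_allocation hsum hmass y).trans_lt hy

lemma measurable_WpPow_empMeas {d N : ℕ} {p : ℝ} (hp : 1 ≤ p)
    (μ : Measure (Fin d → ℝ)) [IsFiniteMeasure μ] (hμ : pMoment p μ ≠ ∞) :
    Measurable fun x : Fin N → Fin d → ℝ => WpPow p μ (empMeas N x) :=
  (upperSemicontinuous_WpPow_empMeas hp μ hμ).measurable

lemma tsum_mul_measure_preimage {α ι : Type*} [MeasurableSpace α] [Countable ι]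
    [MeasurableSpace ι] [MeasurableSingletonClass ι] (μ : Measure α) {π : α → ι}
    (hπ : Measurable π) (F : ι → ℝ≥0∞) :
    ∑' c, F c * μ (π ⁻¹' {c}) = ∫⁻ x, F (π x) ∂μ := by
  rw [← lintegral_map (f := F) (.of_discrete) hπ, lintegral_countable']
  simp_rw [Measure.map_apply hπ (measurableSet_singleton _)]

lemma tsum_subset_measure_preimage {α ι : Type*} [MeasurableSpace α] [Countable ι]
    [MeasurableSpace ι] [MeasurableSingletonClass ι] (μ : Measure α) {π : α → ι}
    (hπ : Measurable π) (S : Set ι) :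
    ∑' c : S, μ (π ⁻¹' {c.1}) = μ (π ⁻¹' S) := by
  rw [← Set.biUnion_preimage_singleton, measure_biUnion S.to_countable]
  · exact fun t _ t' _ h => Set.disjoint_left.2 fun z hz hz' => h (hz.symm.trans hz')
  · exact fun t _ => hπ (measurableSet_singleton t)

/-- A measure rescaled to mass `a c` on each cell `c` of a countable partition. -/
noncomputable def cellScale {α ι : Type*} [MeasurableSpace α] (μ : Measure α)
    (π : α → ι) (a : ι → ℝ≥0∞) : ι → Measure α :=
  fun c => (a c / μ (π ⁻¹' {c})) • μ.restrict (π ⁻¹' {c})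

section cellScale

variable {α ι : Type*} [MeasurableSpace α] {μ : Measure α} [IsFiniteMeasure μ] {π : α → ι}
  {a : ι → ℝ≥0∞}

lemma cellScale_apply_univ (ha : ∀ c, a c ≤ μ (π ⁻¹' {c})) (c : ι) :
    cellScale μ π a c Set.univ = a c := by
  rcases eq_or_ne (μ (π ⁻¹' {c})) 0 with h0 | h0
  · have := ha c
    simp_all [cellScale]
  · simp [cellScale, ENNReal.div_mul_cancel h0 (measure_ne_top _ _)]

variable [MeasurableSpace ι] [MeasurableSingletonClass ι]

lemma cellScale_apply_preimage (hπ : Measurable π) (ha : ∀ c, a c ≤ μ (π ⁻¹' {c}))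
    (c c' : ι) [Decidable (c' = c)] :
    cellScale μ π a c (π ⁻¹' {c'}) = if c' = c then a c else 0 := by
  split_ifs with h
  · subst h
    rw [← cellScale_apply_univ ha c']
    simp [cellScale]
  · have : π ⁻¹' {c'} ∩ π ⁻¹' {c} = ∅ := by
      ext z; simp only [Set.mem_inter_iff, Set.mem_preimage, Set.mem_singleton_iff,
        Set.mem_empty_iff_false, iff_false, not_and]
      intro h1 h2; exact h (h1.symm.trans h2)
    simp [cellScale, Measure.restrict_apply (hπ (measurableSet_singleton c')), this]

lemma sum_cellScale_apply_preimage [Countable ι] (hπ : Measurable π) (ha : ∀ c, a c ≤ μ (π ⁻¹' {c})) (c : ι) :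
    Measure.sum (cellScale μ π a) (π ⁻¹' {c}) = a c := by
  classical
  rw [Measure.sum_apply _ (hπ (measurableSet_singleton c))]
  simp_rw [cellScale_apply_preimage hπ ha]
  rw [tsum_eq_single c (fun c' h => if_neg h.symm), if_pos rfl]

lemma sum_cellScale_add [Countable ι] {b : ι → ℝ≥0∞} (hπ : Measurable π)
    (hab : ∀ c, a c + b c = μ (π ⁻¹' {c})) :
    Measure.sum (cellScale μ π a) + Measure.sum (cellScale μ π b) = μ := by
  rw [Measure.sum_add_sum]
  have : ∀ c, cellScale μ π a c + cellScale μ π b c = μ.restrict (π ⁻¹' {c}) := by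
    intro c
    rw [cellScale, cellScale, ← add_smul, ← ENNReal.add_div, hab]
    rcases eq_or_ne (μ (π ⁻¹' {c})) 0 with h0 | h0
    · rw [Measure.restrict_eq_zero.2 h0, smul_zero]
    · rw [ENNReal.div_self h0 (measure_ne_top _ _), one_smul]
  simp_rw [this]
  rw [← Measure.restrict_iUnion (fun t t' h => Set.disjoint_left.2 fun z hz hz' =>
    h (hz.symm.trans hz')) fun c => hπ (measurableSet_singleton c)]
  rw [← Set.preimage_iUnion, Set.iUnion_of_singleton, Set.preimage_univ, Measure.restrict_univ]

end cellScale

/-- Matching as much mass as possible within the cells of a partition. -/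
lemma exists_residual {d : ℕ} {ι : Type*} [Countable ι] [MeasurableSpace ι]
    [MeasurableSingletonClass ι] {p : ℝ} (μ ν : Measure (Fin d → ℝ)) [IsFiniteMeasure μ]
    [IsFiniteMeasure ν] {π : (Fin d → ℝ) → ι} (hπ : Measurable π) (D : ι → ℝ≥0∞)
    (hD : ∀ x y, π x = π y → (‖x - y‖₊ : ℝ≥0∞) ^ p ≤ D (π x)) :
    ∃ (μ' ν' : Measure (Fin d → ℝ)) (T : Set ι → ℝ≥0∞),
      IsFiniteMeasure μ' ∧ IsFiniteMeasure ν' ∧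
      (∀ S, T S ≠ ∞ ∧ μ' (π ⁻¹' S) + T S = μ (π ⁻¹' S) ∧ ν' (π ⁻¹' S) + T S = ν (π ⁻¹' S)) ∧
      (∀ c, μ' (π ⁻¹' {c}) = μ (π ⁻¹' {c}) - ν (π ⁻¹' {c})) ∧
      (∀ c, ν' (π ⁻¹' {c}) = ν (π ⁻¹' {c}) - μ (π ⁻¹' {c})) ∧
      WpPow p μ ν ≤ WpPow p μ' ν' + ∑' c, D c * μ (π ⁻¹' {c}) := by
  set A : ι → ℝ≥0∞ := fun c => μ (π ⁻¹' {c}) with hA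
  set B : ι → ℝ≥0∞ := fun c => ν (π ⁻¹' {c}) with hB
  have hAm : ∀ c, min (A c) (B c) ≤ A c := fun c => min_le_left _ _
  have hBm : ∀ c, min (A c) (B c) ≤ B c := fun c => min_le_right _ _
  have hAd : ∀ c, A c - B c ≤ A c := fun c => tsub_le_self
  have hBd : ∀ c, B c - A c ≤ B c := fun c => tsub_le_self
  have hAadd : ∀ c, (A c - B c) + min (A c) (B c) = A c := fun c => tsub_add_min
  have hBadd : ∀ c, (B c - A c) + min (A c) (B c) = B c := fun c => by
    rw [min_comm]; exact tsub_add_min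
  have hμ := sum_cellScale_add hπ hAadd
  have hν := sum_cellScale_add hπ hBadd
  set μ' := Measure.sum (cellScale μ π fun c => A c - B c)
  set ν' := Measure.sum (cellScale ν π fun c => B c - A c)
  have hμ' : ∀ c, μ' (π ⁻¹' {c}) = A c - B c := sum_cellScale_apply_preimage hπ hAd
  have hν' : ∀ c, ν' (π ⁻¹' {c}) = B c - A c := sum_cellScale_apply_preimage hπ hBd
  refine ⟨μ', ν', fun S => ∑' c : S, min (A c) (B c), ?_, ?_, fun S => ⟨?_, ?_, ?_⟩,
    hμ', hν', ?_⟩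
  · exact isFiniteMeasure_of_le μ (hμ ▸ Measure.le_add_right le_rfl)
  · exact isFiniteMeasure_of_le ν (hν ▸ Measure.le_add_right le_rfl)
  · refine ne_top_of_le_ne_top (measure_ne_top μ (π ⁻¹' S)) ?_
    rw [← tsum_subset_measure_preimage μ hπ]
    exact ENNReal.tsum_le_tsum fun c => hAm c
  · rw [← tsum_subset_measure_preimage μ' hπ, ← tsum_subset_measure_preimage μ hπ,
      ← ENNReal.tsum_add]
    exact tsum_congr fun c => by rw [hμ', hAadd]
  · rw [← tsum_subset_measure_preimage ν' hπ, ← tsum_subset_measure_preimage ν hπ,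
      ← ENNReal.tsum_add]
    exact tsum_congr fun c => by rw [hν', hBadd]
  · have hcell : ∀ (ρ : Measure (Fin d → ℝ)) (a : ι → ℝ≥0∞) (c : ι),
        ∀ᵐ x ∂cellScale ρ π a c, x ∈ π ⁻¹' {c} := fun ρ a c =>
      Measure.ae_smul_measure (ae_restrict_mem (hπ (measurableSet_singleton c))) _
    have hfin : ∀ (ρ : Measure (Fin d → ℝ)) [IsFiniteMeasure ρ] (a : ι → ℝ≥0∞),
        (∀ c, a c ≤ ρ (π ⁻¹' {c})) → ∀ c, IsFiniteMeasure (cellScale ρ π a c) :=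
      fun ρ _ a ha c => ⟨by
        rw [cellScale_apply_univ ha c]; exact (ha c).trans_lt (measure_lt_top _ _)⟩
    have := hfin μ _ hAm
    have := hfin ν _ hBm
    conv_lhs => rw [← hμ, ← hν]
    refine (WpPow_add_le _ _ _ _).trans (add_le_add le_rfl ?_)
    refine (WpPow_sum_le _ _ (fun c => ?_) D (fun c => π ⁻¹' {c}) (hcell μ _) (hcell ν _)
      ?_).trans ?_
    · rw [cellScale_apply_univ hAm, cellScale_apply_univ hBm]
    · rintro c x rfl y hy
      exact hD x y hy.symm
    · refine ENNReal.tsum_le_tsum fun c => ?_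
      rw [cellScale_apply_univ hAm]
      gcongr
      exact hAm c

/-- Multiscale matching bound on finitely many levels. -/
lemma WpPow_le_multiscale {d : ℕ} {ι : Type*} [Countable ι] [MeasurableSpace ι]
    [MeasurableSingletonClass ι] {p : ℝ} (hp : 1 ≤ p) (π : ℕ → (Fin d → ℝ) → ι)
    (hπ : ∀ l, Measurable (π l)) (par : ℕ → ι → ι) (hpar : ∀ l x, π l x = par l (π (l + 1) x))
    (D : ℕ → ι → ℝ≥0∞) (hD : ∀ l x y, π l x = π l y → (‖x - y‖₊ : ℝ≥0∞) ^ p ≤ D l (π l x))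
    (R : ι → ℝ≥0∞) (hR : ∀ x, (‖x‖₊ : ℝ≥0∞) ^ p ≤ R (π 0 x)) (L : ℕ)
    (μ ν : Measure (Fin d → ℝ)) [IsFiniteMeasure μ] [IsFiniteMeasure ν]
    (h : μ Set.univ = ν Set.univ) :
    WpPow p μ ν ≤ ∑' c, D L c * μ (π L ⁻¹' {c})
      + ∑ l ∈ Finset.range L, ∑' c, D l (par l c) *
          (μ (π (l + 1) ⁻¹' {c}) - ν (π (l + 1) ⁻¹' {c}))
      + 2 ^ p * ∑' c, R c * ((μ (π 0 ⁻¹' {c}) - ν (π 0 ⁻¹' {c}))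
          + (ν (π 0 ⁻¹' {c}) - μ (π 0 ⁻¹' {c}))) := by
  induction L generalizing μ ν with
  | zero =>
    obtain ⟨μ', ν', T, _, _, hT, hμ', hν', hW⟩ := exists_residual μ ν (hπ 0) (D 0) (hD 0)
    have hmass : μ' Set.univ = ν' Set.univ := by
      obtain ⟨h1, h2, h3⟩ := hT Set.univ
      simp only [Set.preimage_univ] at h2 h3
      rw [← h2, ← h3] at h
      exact (ENNReal.add_left_inj h1).1 h
    have hmom : ∀ ρ : Measure (Fin d → ℝ), pMoment p ρ ≤ ∑' c, R c * ρ (π 0 ⁻¹' {c}) := by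
      intro ρ
      rw [tsum_mul_measure_preimage ρ (hπ 0) R]
      exact lintegral_mono hR
    rw [Finset.range_zero, Finset.sum_empty, add_zero]
    calc WpPow p μ ν ≤ WpPow p μ' ν' + ∑' c, D 0 c * μ (π 0 ⁻¹' {c}) := hW
      _ ≤ 2 ^ p * (∑' c, R c * μ' (π 0 ⁻¹' {c}) + ∑' c, R c * ν' (π 0 ⁻¹' {c}))
          + ∑' c, D 0 c * μ (π 0 ⁻¹' {c}) := by
          gcongr
          refine (WpPow_le_pMoment hp hmass).trans ?_
          gcongr
          · exact hmom μ'
          · exact hmom ν'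
      _ = _ := by
          rw [← ENNReal.tsum_add, add_comm]
          simp_rw [hμ', hν', mul_add]
  | succ L ih =>
    obtain ⟨μ', ν', T, _, _, hT, hμ', hν', hW⟩ :=
      exists_residual μ ν (hπ (L + 1)) (D (L + 1)) (hD (L + 1))
    have hmass : μ' Set.univ = ν' Set.univ := by
      obtain ⟨h1, h2, h3⟩ := hT Set.univ
      simp only [Set.preimage_univ] at h2 h3
      rw [← h2, ← h3] at h
      exact (ENNReal.add_left_inj h1).1 h
    have hanc : ∀ l ≤ L + 1, ∃ q : ι → ι, ∀ x, π l x = q (π (L + 1) x) := by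
      intro l hl
      induction hl using Nat.decreasingInduction with
      | self => exact ⟨id, fun x => rfl⟩
      | of_succ l _ ih' =>
        obtain ⟨q, hq⟩ := ih'
        exact ⟨par l ∘ q, fun x => by rw [hpar, hq]; rfl⟩
    have hsub : ∀ l ≤ L + 1, ∀ c,
        μ' (π l ⁻¹' {c}) - ν' (π l ⁻¹' {c}) = μ (π l ⁻¹' {c}) - ν (π l ⁻¹' {c}) ∧
        ν' (π l ⁻¹' {c}) - μ' (π l ⁻¹' {c}) = ν (π l ⁻¹' {c}) - μ (π l ⁻¹' {c}) := by
      intro l hl c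
      obtain ⟨q, hq⟩ := hanc l hl
      have hset : π l ⁻¹' {c} = π (L + 1) ⁻¹' (q ⁻¹' {c}) := by
        ext x; simp [hq x]
      obtain ⟨h1, h2, h3⟩ := hT (q ⁻¹' {c})
      rw [hset, ← h2, ← h3]
      have key : ∀ a b t : ℝ≥0∞, t ≠ ∞ → a - b = (a + t) - (b + t) := fun a b t ht => by
        rw [tsub_add_eq_tsub_tsub_swap, ENNReal.add_sub_cancel_right ht]
      exact ⟨key _ _ _ h1, key _ _ _ h1⟩
    have hfirst : ∑' c, D L c * μ' (π L ⁻¹' {c}) = ∑' c, D L (par L c) *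
        (μ (π (L + 1) ⁻¹' {c}) - ν (π (L + 1) ⁻¹' {c})) := by
      simp_rw [← hμ']
      rw [tsum_mul_measure_preimage μ' (hπ L), tsum_mul_measure_preimage μ' (hπ (L + 1))
        fun c => D L (par L c)]
      simp_rw [hpar L]
    have hih := ih μ' ν' hmass
    rw [hfirst] at hih
    have hmid : ∑ l ∈ Finset.range L, ∑' c, D l (par l c) *
          (μ' (π (l + 1) ⁻¹' {c}) - ν' (π (l + 1) ⁻¹' {c})) =
        ∑ l ∈ Finset.range L, ∑' c, D l (par l c) *
          (μ (π (l + 1) ⁻¹' {c}) - ν (π (l + 1) ⁻¹' {c})) := by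
      refine Finset.sum_congr rfl fun l hl => tsum_congr fun c => ?_
      rw [(hsub (l + 1) (by simp at hl; omega) c).1]
    rw [hmid] at hih
    simp_rw [fun c => (hsub 0 (by omega) c).1, fun c => (hsub 0 (by omega) c).2] at hih
    refine hW.trans ((add_le_add hih le_rfl).trans (le_of_eq ?_))
    rw [Finset.sum_range_succ]
    ring

section

open ProbabilityTheory

lemma lintegral_rpow_le_rpow_lintegral {α : Type*} [MeasurableSpace α] (μ : Measure α)
    [IsProbabilityMeasure μ] {f : α → ℝ≥0∞} (hf : Measurable f) {θ : ℝ} (h0 : 0 < θ)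
    (h1 : θ ≤ 1) : ∫⁻ x, f x ^ θ ∂μ ≤ (∫⁻ x, f x ∂μ) ^ θ := by
  have h := eLpNorm'_le_eLpNorm'_of_exponent_le (f := f) h0 h1 μ hf.aestronglyMeasurable
  simp only [eLpNorm', enorm_eq_self, ENNReal.rpow_one, one_div, inv_one] at h
  calc ∫⁻ x, f x ^ θ ∂μ = ((∫⁻ x, f x ^ θ ∂μ) ^ θ⁻¹) ^ θ := by
        rw [← ENNReal.rpow_mul, inv_mul_cancel₀ h0.ne', ENNReal.rpow_one]
    _ ≤ _ := by gcongr

/-- The fraction of the sample `x` lying in `A`. -/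
noncomputable def freq {α : Type*} (N : ℕ) (A : Set α) (x : Fin N → α) : ℝ≥0∞ :=
  (N : ℝ≥0∞)⁻¹ * ∑ j, A.indicator 1 (x j)

lemma measurable_freq {α : Type*} [MeasurableSpace α] (N : ℕ) {A : Set α}
    (hA : MeasurableSet A) : Measurable (freq N A) := by
  have h : Measurable (A.indicator (1 : α → ℝ≥0∞)) := measurable_one.indicator hA
  unfold freq
  fun_prop

lemma lintegral_freq {α : Type*} [MeasurableSpace α] (P : Measure α) [IsProbabilityMeasure P]
    {N : ℕ} (hN : N ≠ 0) {A : Set α} (hA : MeasurableSet A) :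
    ∫⁻ x, freq N A x ∂(Measure.pi fun _ : Fin N => P) = P A := by
  have h : Measurable (A.indicator (1 : α → ℝ≥0∞)) := measurable_one.indicator hA
  unfold freq
  rw [lintegral_const_mul _ (by fun_prop), lintegral_finsetSum _ (fun j _ => by fun_prop)]
  have : ∀ j : Fin N, ∫⁻ x, A.indicator (1 : α → ℝ≥0∞) (x j) ∂(Measure.pi fun _ : Fin N => P)
      = P A := fun j => by
    rw [(measurePreserving_eval (fun _ : Fin N => P) j).lintegral_comp h, lintegral_indicator_one hA]
  simp_rw [this]
  simp [← mul_assoc, ENNReal.inv_mul_cancel (Nat.cast_ne_zero.2 hN) (natCast_ne_top N)]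

lemma lintegral_freq_dev_le {α : Type*} [MeasurableSpace α] (P : Measure α)
    [IsProbabilityMeasure P] {N : ℕ} (hN : N ≠ 0) {A : Set α} (hA : MeasurableSet A) :
    ∫⁻ x, ((P A - freq N A x) + (freq N A x - P A)) ∂(Measure.pi fun _ : Fin N => P)
      ≤ (P A / N) ^ (1 / 2 : ℝ) := by
  set Q := Measure.pi fun _ : Fin N => P
  let X : Fin N → α → ℝ := fun _ => A.indicator 1
  have hXm : Measurable (A.indicator (1 : α → ℝ)) := measurable_one.indicator hA
  have hmem : ∀ j, MemLp (X j) 2 P := fun j => (memLp_indicator_const 2 hA 1 (by simp))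
  have hint : ∀ j : Fin N, ∫ x, X j (x j) ∂Q = P.real A := fun j => by
    rw [integral_comp_eval (μ := fun _ : Fin N => P) (i := j) hXm.aestronglyMeasurable]
    exact integral_indicator_one hA
  have hvarX : ∀ j, Var[X j; P] ≤ P.real A := fun j => by
    refine (variance_le_expectation_sq hXm.aestronglyMeasurable).trans (le_of_eq ?_)
    rw [← integral_indicator_one hA]
    congr 1 with x
    by_cases hx : x ∈ A <;> simp [hx]
  let S : (Fin N → α) → ℝ := ∑ j, fun x => X j (x j)
  have hSmem : MemLp S 2 Q := memLp_finsetSum' _ fun j _ =>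
    (hmem j).comp_measurePreserving (measurePreserving_eval (fun _ : Fin N => P) j)
  have hvarS : Var[S; Q] ≤ N * P.real A := by
    have := variance_sum_pi (μ := fun _ : Fin N => P) hmem
    rw [this]
    calc _ ≤ ∑ _j : Fin N, P.real A := Finset.sum_le_sum fun j _ => hvarX j
      _ = _ := by simp
  have hES : ∫ x, S x ∂Q = N * P.real A := by
    have h1 : ∀ x, S x = ∑ j, X j (x j) := fun x => by simp [S]
    simp_rw [h1]
    rw [integral_finsetSum _ fun j _ => ?_]
    · simp_rw [hint]; simp
    · exact ((hmem j).comp_measurePreserving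
        (measurePreserving_eval (fun _ : Fin N => P) j)).integrable one_le_two
  have hN' : (0 : ℝ) < N := Nat.cast_pos.2 (Nat.pos_of_ne_zero hN)
  have hfreq : ∀ x, freq N A x = ENNReal.ofReal ((N : ℝ)⁻¹ * S x) := by
    intro x
    have hnn : ∀ j, 0 ≤ A.indicator (1 : α → ℝ) (x j) := fun j =>
      Set.indicator_nonneg (fun _ _ => zero_le_one) _
    have h1 : S x = ∑ j, A.indicator (1 : α → ℝ) (x j) := by simp [S, X]
    rw [h1, ENNReal.ofReal_mul (by positivity), ENNReal.ofReal_inv_of_pos hN',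
      ENNReal.ofReal_natCast, ENNReal.ofReal_sum_of_nonneg fun j _ => hnn j, freq]
    congr 1
    refine Finset.sum_congr rfl fun j _ => ?_
    by_cases hx : x j ∈ A <;> simp [hx]
  have habs : ∀ a b : ℝ, 0 ≤ a → 0 ≤ b →
      (ENNReal.ofReal a - ENNReal.ofReal b) + (ENNReal.ofReal b - ENNReal.ofReal a)
        = ‖b - a‖ₑ := by
    intro a b ha hb
    rw [← ENNReal.ofReal_sub _ hb, ← ENNReal.ofReal_sub _ ha, Real.enorm_eq_ofReal_abs]
    rcases le_total a b with h | h
    · rw [ENNReal.ofReal_of_nonpos (sub_nonpos.2 h), zero_add, abs_of_nonneg (sub_nonneg.2 h)]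
    · rw [ENNReal.ofReal_of_nonpos (sub_nonpos.2 h), add_zero, abs_of_nonpos (sub_nonpos.2 h),
        neg_sub]
  have hpt : ∀ x, (P A - freq N A x) + (freq N A x - P A)
      = (N : ℝ≥0∞)⁻¹ * ‖S x - ∫ y, S y ∂Q‖ₑ := by
    intro x
    have hS0 : 0 ≤ S x := by
      have h1 : S x = ∑ j, A.indicator (1 : α → ℝ) (x j) := by simp [S, X]
      rw [h1]
      exact Finset.sum_nonneg fun j _ => Set.indicator_nonneg (fun _ _ => zero_le_one) _
    rw [hfreq, ← ofReal_measureReal (μ := P) (s := A), habs _ _ measureReal_nonneg (by positivity),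
      hES]
    have : (N : ℝ)⁻¹ * S x - P.real A = (N : ℝ)⁻¹ * (S x - N * P.real A) := by
      field_simp
    rw [this, enorm_mul]
    congr 1
    rw [Real.enorm_eq_ofReal (by positivity), ENNReal.ofReal_inv_of_pos hN', ENNReal.ofReal_natCast]
  have hSm : Measurable S := by
    have h1 : S = fun x => ∑ j, A.indicator (1 : α → ℝ) (x j) := by ext x; simp [S, X]
    rw [h1]; fun_prop
  have hgm : Measurable fun x => ‖S x - ∫ y, S y ∂Q‖ₑ := by fun_prop
  simp_rw [hpt]
  rw [lintegral_const_mul _ hgm]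
  have hcs := lintegral_rpow_le_rpow_lintegral Q (hgm.pow_const (2 : ℕ)) (θ := 1 / 2)
    (by norm_num) (by norm_num)
  have hroot : ∀ t : ℝ≥0∞, (t ^ 2) ^ (1 / 2 : ℝ) = t := fun t => by
    rw [← ENNReal.rpow_natCast, ← ENNReal.rpow_mul]; norm_num
  simp_rw [hroot] at hcs
  have hev : ∫⁻ x, ‖S x - ∫ y, S y ∂Q‖ₑ ^ 2 ∂Q ≤ N * P A := by
    change evariance S Q ≤ _
    rw [← hSmem.ofReal_variance_eq, ← ofReal_measureReal (μ := P) (s := A),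
      ← ENNReal.ofReal_natCast, ← ENNReal.ofReal_mul hN'.le]
    exact ENNReal.ofReal_le_ofReal hvarS
  calc (N : ℝ≥0∞)⁻¹ * ∫⁻ x, ‖S x - ∫ y, S y ∂Q‖ₑ ∂Q
      ≤ (N : ℝ≥0∞)⁻¹ * (N * P A) ^ (1 / 2 : ℝ) := by
        gcongr
        exact hcs.trans (by gcongr)
    _ = (((N : ℝ≥0∞)⁻¹) ^ 2 * (N * P A)) ^ (1 / 2 : ℝ) := by
        rw [ENNReal.mul_rpow_of_nonneg (((N : ℝ≥0∞)⁻¹) ^ 2) _ (by norm_num), hroot]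
    _ = (P A / N) ^ (1 / 2 : ℝ) := by
        congr 1
        rw [sq, mul_assoc, ← mul_assoc _ (N : ℝ≥0∞),
          ENNReal.inv_mul_cancel (Nat.cast_ne_zero.2 hN) (natCast_ne_top N), one_mul,
          ENNReal.div_eq_inv_mul]

lemma lintegral_freq_dev_le_two_mul {α : Type*} [MeasurableSpace α] (P : Measure α)
    [IsProbabilityMeasure P] {N : ℕ} (hN : N ≠ 0) {A : Set α} (hA : MeasurableSet A) :
    ∫⁻ x, ((P A - freq N A x) + (freq N A x - P A)) ∂(Measure.pi fun _ : Fin N => P)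
      ≤ 2 * P A := by
  calc _ ≤ ∫⁻ x, (P A + freq N A x) ∂(Measure.pi fun _ : Fin N => P) :=
        lintegral_mono fun x => add_le_add tsub_le_self tsub_le_self
    _ = 2 * P A := by
        rw [lintegral_add_left measurable_const, lintegral_freq P hN hA, lintegral_const,
          measure_univ, mul_one, two_mul]

end

/-- The index of the dyadic shell `{2 ^ (n - 1) ≤ ‖x‖ < 2 ^ n}` (or `{‖x‖ < 1}`) containing `x`. -/
noncomputable def shell {d : ℕ} (x : Fin d → ℝ) : ℕ := Nat.clog 2 (⌊‖x‖⌋₊ + 1)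

lemma measurable_shell {d : ℕ} : Measurable (shell (d := d)) := by
  unfold shell
  exact (measurable_from_top (f := fun k : ℕ => Nat.clog 2 (k + 1))).comp
    (Nat.measurable_floor.comp measurable_norm)

lemma norm_lt_two_pow_shell {d : ℕ} (x : Fin d → ℝ) : ‖x‖ < 2 ^ shell x := by
  have h1 := Nat.lt_floor_add_one ‖x‖
  have h2 : ⌊‖x‖⌋₊ + 1 ≤ 2 ^ shell x := Nat.le_pow_clog (by norm_num) _
  have h3 : ((⌊‖x‖⌋₊ : ℝ) + 1) ≤ 2 ^ shell x := by exact_mod_cast h2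
  linarith

lemma two_pow_le_norm_of_shell {d : ℕ} {x : Fin d → ℝ} {n : ℕ} (h : shell x = n + 1) :
    2 ^ n ≤ ‖x‖ := by
  have h1 : ¬ (⌊‖x‖⌋₊ + 1 ≤ 2 ^ n) := fun hc => by
    have := (Nat.clog_le_iff_le_pow (b := 2) (by norm_num)).2 hc
    unfold shell at h; omega
  have h2 : 2 ^ n ≤ ⌊‖x‖⌋₊ := by omega
  calc (2 : ℝ) ^ n = ((2 ^ n : ℕ) : ℝ) := by push_cast; rfl
    _ ≤ ⌊‖x‖⌋₊ := by exact_mod_cast h2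
    _ ≤ ‖x‖ := Nat.floor_le (norm_nonneg x)

lemma shell_eq_zero_of_norm_lt {d : ℕ} {x : Fin d → ℝ} (h : ‖x‖ < 1) : shell x = 0 := by
  have : ⌊‖x‖⌋₊ = 0 := Nat.floor_eq_zero.2 h
  simp [shell, this]

/-- The dyadic cell of generation `l` inside its shell containing `x`. -/
noncomputable def cell {d : ℕ} (l : ℕ) (x : Fin d → ℝ) : ℕ × (Fin d → ℤ) :=
  (shell x, fun i => ⌊2 ^ l * (x i / 2 ^ shell x)⌋)

lemma measurable_cell {d : ℕ} (l : ℕ) : Measurable (cell (d := d) l) := by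
  have h : Measurable fun x : Fin d → ℝ => (2 : ℝ) ^ shell x :=
    (measurable_from_top (f := fun k : ℕ => (2 : ℝ) ^ k)).comp measurable_shell
  refine measurable_shell.prodMk (measurable_pi_lambda _ fun i => Int.measurable_floor.comp ?_)
  exact measurable_const.mul ((measurable_pi_apply i).div h)

lemma cell_eq_parent {d : ℕ} (l : ℕ) (x : Fin d → ℝ) :
    cell l x = ((cell (l + 1) x).1, fun i => (cell (l + 1) x).2 i / 2) := by
  refine Prod.ext rfl (funext fun i => ?_)
  have := Int.floor_div_natCast ((2 : ℝ) ^ (l + 1) * (x i / 2 ^ shell x)) 2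
  simp only [cell]
  rw [show ((2 : ℤ)) = ((2 : ℕ) : ℤ) by rfl, ← this]
  congr 1
  push_cast
  rw [pow_succ]; ring

lemma norm_sub_le_of_cell_eq {d : ℕ} {l : ℕ} {x y : Fin d → ℝ} (h : cell l x = cell l y) :
    ‖x - y‖ ≤ 2 ^ shell x / 2 ^ l := by
  have h1 : shell x = shell y := congrArg Prod.fst h
  have h2 := congrArg Prod.snd h
  refine (pi_norm_le_iff_of_nonneg (by positivity)).2 fun i => ?_
  have h3 := congrFun h2 i
  simp only [cell, ← h1] at h3
  have h4 := Int.abs_sub_lt_one_of_floor_eq_floor h3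
  rw [← mul_sub, ← sub_div, abs_mul, abs_div, abs_of_pos (by positivity : (0 : ℝ) < 2 ^ l),
    abs_of_pos (by positivity : (0 : ℝ) < 2 ^ shell x)] at h4
  rw [Real.norm_eq_abs, Pi.sub_apply, le_div_iff₀ (by positivity)]
  have h5 : |x i - y i| * 2 ^ l = 2 ^ l * (|x i - y i| / 2 ^ shell x) * 2 ^ shell x := by
    field_simp
  rw [h5]
  nlinarith [(by positivity : (0 : ℝ) < 2 ^ shell x)]

lemma cell_snd_mem {d : ℕ} (l : ℕ) (x : Fin d → ℝ) :
    (cell l x).2 ∈ Fintype.piFinset fun _ : Fin d => Finset.Ico (-2 ^ l : ℤ) (2 ^ l) := by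
  refine Fintype.mem_piFinset.2 fun i => Finset.mem_Ico.2 ?_
  have h1 : |x i| < 2 ^ shell x := (norm_le_pi_norm x i).trans_lt (norm_lt_two_pow_shell x)
  have h2 : |x i / 2 ^ shell x| < 1 := by
    rw [abs_div, abs_of_pos (by positivity : (0 : ℝ) < 2 ^ shell x), div_lt_one (by positivity)]
    exact h1
  have h3 := abs_lt.1 h2
  have h4 : (0 : ℝ) < 2 ^ l := by positivity
  simp only [cell]
  refine ⟨Int.le_floor.2 ?_, Int.floor_lt.2 ?_⟩ <;> push_cast <;> nlinarith

lemma WpPow_le_tsum_cell {d : ℕ} {p : ℝ} (hp : 1 ≤ p)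
    (μ ν : Measure (Fin d → ℝ)) [IsFiniteMeasure μ] [IsFiniteMeasure ν]
    (h : μ Set.univ = ν Set.univ) (L : ℕ) :
    WpPow p μ ν ≤ 2 ^ (-(p * L)) * (∑' c : ℕ × (Fin d → ℤ), 2 ^ (p * c.1) * μ (cell L ⁻¹' {c}))
      + 2 ^ p * ∑' (l : ℕ) (c : ℕ × (Fin d → ℤ)), 2 ^ (p * ((c.1 : ℝ) - l)) *
        ((μ (cell l ⁻¹' {c}) - ν (cell l ⁻¹' {c}))
          + (ν (cell l ⁻¹' {c}) - μ (cell l ⁻¹' {c}))) := by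
  have hp0 : 0 ≤ p := by linarith
  have key : ∀ (r : ℝ) (e : ℝ) (z : Fin d → ℝ), ‖z‖ ≤ 2 ^ e → p * e = r →
      (‖z‖₊ : ℝ≥0∞) ^ p ≤ 2 ^ r := by
    intro r e z hz hr
    have : (‖z‖₊ : ℝ≥0∞) ≤ 2 ^ e := by
      rw [← enorm_eq_nnnorm, ← ofReal_norm, ← ofReal_ofNat 2, ofReal_rpow_of_pos (by norm_num)]
      exact ofReal_le_ofReal hz
    calc (‖z‖₊ : ℝ≥0∞) ^ p ≤ (2 ^ e) ^ p := by gcongr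
      _ = 2 ^ r := by rw [← ENNReal.rpow_mul, mul_comm, hr]
  have hmul := WpPow_le_multiscale hp (fun l => cell (d := d) l) measurable_cell
    (fun _ c => (c.1, fun i => c.2 i / 2)) cell_eq_parent
    (fun l c => 2 ^ (p * ((c.1 : ℝ) - l)))
    (fun l x y hxy => key _ ((shell x : ℝ) - l) _ (by
      rw [Real.rpow_sub (by norm_num), Real.rpow_natCast, Real.rpow_natCast]
      exact norm_sub_le_of_cell_eq hxy) rfl)
    (fun c => 2 ^ (p * c.1))
    (fun x => key _ (shell x : ℝ) _ (by
      rw [Real.rpow_natCast]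
      exact (norm_lt_two_pow_shell x).le) rfl) L μ ν h
  refine hmul.trans ?_
  rw [add_assoc]
  set G : ℕ → ℝ≥0∞ := fun l => ∑' c : ℕ × (Fin d → ℤ), 2 ^ (p * ((c.1 : ℝ) - l)) *
        ((μ (cell l ⁻¹' {c}) - ν (cell l ⁻¹' {c}))
          + (ν (cell l ⁻¹' {c}) - μ (cell l ⁻¹' {c}))) with hG
  refine add_le_add (le_of_eq ?_) ?_
  · rw [← ENNReal.tsum_mul_left]
    refine tsum_congr fun c => ?_
    rw [← mul_assoc, ← ENNReal.rpow_add _ _ (by norm_num) (by norm_num)]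
    congr 2; ring
  · have h1 : ∑ l ∈ Finset.range L, G (l + 1) + G 0 ≤ ∑' l, G l := by
      rw [← Finset.sum_range_succ']
      exact ENNReal.sum_le_tsum _
    refine le_trans ?_ (mul_le_mul_right h1 (2 ^ p))
    rw [mul_add, Finset.mul_sum]
    refine add_le_add (Finset.sum_le_sum fun l _ => ?_) ?_
    · rw [hG, ← ENNReal.tsum_mul_left]
      refine ENNReal.tsum_le_tsum fun c => ?_
      rw [← mul_assoc, ← ENNReal.rpow_add _ _ (by norm_num) (by norm_num)]
      refine mul_le_mul' (le_of_eq ?_) le_self_add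
      congr 1; push_cast; ring
    · simp [hG]

lemma tsum_int_two_rpow_ne_top {δ : ℝ} (hδ : 0 < δ) :
    ∑' z : ℤ, (2 : ℝ≥0∞) ^ (-(δ * |(z : ℝ)|)) ≠ ∞ := by
  have h1 : (2 : ℝ) ^ (-δ) < 1 := Real.rpow_lt_one_of_one_lt_of_neg (by norm_num) (by linarith)
  have h0 : (0 : ℝ) < 2 ^ (-δ) := by positivity
  have hn : Summable fun n : ℕ => (2 : ℝ) ^ (-(δ * (n : ℝ))) := by
    refine (summable_geometric_of_lt_one h0.le h1).congr fun n => ?_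
    rw [← Real.rpow_mul_natCast (by norm_num)]; congr 1; ring
  have hs : Summable fun z : ℤ => (2 : ℝ) ^ (-(δ * |(z : ℝ)|)) := by
    refine Summable.of_nat_of_neg (hn.congr fun n => ?_) (hn.congr fun n => ?_) <;> simp
  convert hs.tsum_ofReal_ne_top using 3 with z
  rw [← ofReal_ofNat 2, ofReal_rpow_of_pos (by norm_num)]

lemma exists_tsum_scale_le {d : ℕ} {p : ℝ} (hp : 0 < p) (hpd : 2 * p < d) :
    ∃ C : ℝ≥0∞, C ≠ ∞ ∧ ∀ M : ℝ≥0∞, M ≠ 0 → M ≠ ∞ →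
      ∑' l : ℕ, (2 : ℝ≥0∞) ^ (-(p * l)) * min 1 ((2 ^ ((d : ℝ) * l) / M) ^ (1 / 2 : ℝ))
        ≤ C * M ^ (-(p / d)) := by
  have hd : (0 : ℝ) < d := by linarith
  set δ := min p (d / 2 - p) with hδdef
  have hδ : 0 < δ := lt_min hp (by linarith)
  have hδ1 : δ ≤ p := min_le_left _ _
  have hδ2 : δ ≤ d / 2 - p := min_le_right _ _
  refine ⟨2 ^ δ * ∑' z : ℤ, (2 : ℝ≥0∞) ^ (-(δ * |(z : ℝ)|)),
    mul_ne_top (rpow_ne_top_of_nonneg hδ.le (by norm_num)) (tsum_int_two_rpow_ne_top hδ), ?_⟩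
  intro M hM0 hM1
  obtain ⟨t, rfl⟩ : ∃ t : ℝ, M = 2 ^ (d * t) := by
    refine ⟨Real.logb 2 M.toReal / d, ?_⟩
    rw [mul_div_cancel₀ _ hd.ne', ← ofReal_ofNat 2, ofReal_rpow_of_pos (by norm_num),
      Real.rpow_logb (by norm_num) (by norm_num) (toReal_pos hM0 hM1), ofReal_toReal hM1]
  have hterm : ∀ l : ℕ, (2 : ℝ≥0∞) ^ (-(p * l)) *
      min 1 ((2 ^ ((d : ℝ) * l) / 2 ^ (d * t)) ^ (1 / 2 : ℝ))
      ≤ 2 ^ (-(p * t)) * 2 ^ δ * 2 ^ (-(δ * |((l - ⌊t⌋ : ℤ) : ℝ)|)) := by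
    intro l
    have h2 : ((2 : ℝ≥0∞) ^ ((d : ℝ) * l) / 2 ^ (d * t)) ^ (1 / 2 : ℝ) = 2 ^ (d * (l - t) / 2) := by
      rw [← ENNReal.rpow_sub _ _ (by norm_num) (by norm_num), ← ENNReal.rpow_mul]
      congr 1; ring
    rw [h2, ← ENNReal.rpow_add _ _ (by norm_num) (by norm_num),
      ← ENNReal.rpow_add _ _ (by norm_num) (by norm_num)]
    have hf1 := Int.floor_le t
    have hf2 := Int.lt_floor_add_one t
    push_cast
    have habs : |(l : ℝ) - ⌊t⌋| ≤ |l - t| + 1 := by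
      have : (l : ℝ) - ⌊t⌋ = (l - t) + (t - ⌊t⌋) := by ring
      rw [this]
      refine (abs_add_le _ _).trans ?_
      gcongr
      rw [abs_of_nonneg (by linarith)]; linarith
    rcases le_total t l with htl | htl
    · refine (mul_le_mul' le_rfl (min_le_left _ _)).trans ?_
      rw [mul_one]
      refine ENNReal.rpow_le_rpow_of_exponent_le (by norm_num) ?_
      rw [abs_of_nonneg (by linarith : 0 ≤ (l : ℝ) - t)] at habs
      nlinarith
    · refine (mul_le_mul' le_rfl (min_le_right _ _)).trans ?_
      rw [← ENNReal.rpow_add _ _ (by norm_num) (by norm_num)]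
      refine ENNReal.rpow_le_rpow_of_exponent_le (by norm_num) ?_
      rw [abs_of_nonpos (by linarith : (l : ℝ) - t ≤ 0)] at habs
      nlinarith
  calc _ ≤ ∑' l : ℕ, (2 : ℝ≥0∞) ^ (-(p * t)) * 2 ^ δ * 2 ^ (-(δ * |((l - ⌊t⌋ : ℤ) : ℝ)|)) :=
        ENNReal.tsum_le_tsum hterm
    _ = 2 ^ (-(p * t)) * 2 ^ δ * ∑' l : ℕ, (2 : ℝ≥0∞) ^ (-(δ * |((l - ⌊t⌋ : ℤ) : ℝ)|)) :=
        ENNReal.tsum_mul_left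
    _ ≤ 2 ^ (-(p * t)) * 2 ^ δ * ∑' z : ℤ, (2 : ℝ≥0∞) ^ (-(δ * |(z : ℝ)|)) := by
        gcongr
        exact ENNReal.tsum_comp_le_tsum_of_injective
          (f := fun l : ℕ => ((l : ℤ) - ⌊t⌋)) (fun a b hab => by simpa using hab)
          (fun z : ℤ => (2 : ℝ≥0∞) ^ (-(δ * |(z : ℝ)|)))
    _ = _ := by
        rw [← ENNReal.rpow_mul, show d * t * -(p / d) = -(p * t) by field_simp]
        ring

lemma sum_rpow_half_le {ι : Type*} (s : Finset ι) (a : ι → ℝ≥0∞) :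
    ∑ i ∈ s, a i ^ (1 / 2 : ℝ) ≤ (s.card * ∑ i ∈ s, a i) ^ (1 / 2 : ℝ) := by
  have h := ENNReal.inner_le_Lp_mul_Lq s (fun _ => 1) (fun i => a i ^ (1 / 2 : ℝ))
    (p := 2) (q := 2) (Real.HolderConjugate.two_two)
  simp_rw [← ENNReal.rpow_mul] at h
  norm_num at h
  rw [← ENNReal.mul_rpow_of_nonneg _ _ (by norm_num)] at h
  simpa using h

lemma tsum_cell_lintegral_dev_le {d : ℕ} (μ : Measure (Fin d → ℝ)) [IsProbabilityMeasure μ]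
    {N : ℕ} (hN : N ≠ 0) (n l : ℕ) :
    ∑' k : Fin d → ℤ, ∫⁻ x, ((μ (cell l ⁻¹' {(n, k)}) - freq N (cell l ⁻¹' {(n, k)}) x)
        + (freq N (cell l ⁻¹' {(n, k)}) x - μ (cell l ⁻¹' {(n, k)}))) ∂(Measure.pi fun _ => μ)
      ≤ 2 ^ (1 + d / 2 : ℝ) * μ (shell ⁻¹' {n}) *
        min 1 ((2 ^ ((d : ℝ) * l) / (μ (shell ⁻¹' {n}) * N)) ^ (1 / 2 : ℝ)) := by
  set m := μ (shell ⁻¹' {n}) with hm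
  set A : (Fin d → ℤ) → Set (Fin d → ℝ) := fun k => cell l ⁻¹' {(n, k)} with hA
  have hAm : ∀ k, MeasurableSet (A k) := fun k => measurable_cell l (measurableSet_singleton _)
  have hsum : ∑' k, μ (A k) = m := by
    rw [← measure_iUnion]
    · congr 1; ext x
      simp only [hA, Set.mem_iUnion, Set.mem_preimage, Set.mem_singleton_iff, cell, Prod.mk.injEq,
        exists_and_left, exists_eq', and_true]
    · intro k k' hk
      exact Set.disjoint_left.2 fun x h1 h2 => hk (congrArg Prod.snd
        ((Set.mem_singleton_iff.1 h1).symm.trans (Set.mem_singleton_iff.1 h2)))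
    · exact hAm
  have h2m : ∑' k, ∫⁻ x, ((μ (A k) - freq N (A k) x) + (freq N (A k) x - μ (A k)))
      ∂(Measure.pi fun _ => μ) ≤ 2 * m := by
    rw [← hsum, ← ENNReal.tsum_mul_left]
    exact ENNReal.tsum_le_tsum fun k => lintegral_freq_dev_le_two_mul μ hN (hAm k)
  rcases eq_or_ne m 0 with h0 | h0
  · rw [h0] at h2m ⊢
    simpa using h2m
  have hmt : m ≠ ∞ := measure_ne_top _ _
  have hNt : (N : ℝ≥0∞) ≠ 0 := Nat.cast_ne_zero.2 hN
  rw [mul_min, mul_one]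
  refine le_min (h2m.trans ?_) ?_
  · gcongr
    calc (2 : ℝ≥0∞) = 2 ^ (1 : ℝ) := by simp
      _ ≤ _ := ENNReal.rpow_le_rpow_of_exponent_le (by norm_num) (by
        have : (0 : ℝ) ≤ d := by positivity
        linarith)
  · set K := Fintype.piFinset fun _ : Fin d => Finset.Ico (-2 ^ l : ℤ) (2 ^ l) with hK
    have hcard : K.card = (2 * 2 ^ l) ^ d := by
      rw [hK, Fintype.card_piFinset]
      simp only [Int.card_Ico, sub_neg_eq_add, Finset.prod_const, Finset.card_univ,
        Fintype.card_fin]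
      congr 1
      rw [← two_mul]; norm_cast
    have hempty : ∀ k ∉ K, A k = ∅ := fun k hk => by
      ext x
      simp only [hA, Set.mem_preimage, Set.mem_singleton_iff, Set.mem_empty_iff_false, iff_false]
      intro hx
      exact hk (by have := cell_snd_mem l x; rwa [hx] at this)
    rw [tsum_eq_sum (s := K) (fun k hk => by
      change ∫⁻ x, ((μ (A k) - freq N (A k) x) + (freq N (A k) x - μ (A k))) ∂_ = 0
      rw [hempty k hk]; simp [freq])]
    calc _ ≤ ∑ k ∈ K, (μ (A k) / N) ^ (1 / 2 : ℝ) :=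
          Finset.sum_le_sum fun k _ => lintegral_freq_dev_le μ hN (hAm k)
      _ ≤ (K.card * ∑ k ∈ K, μ (A k) / N) ^ (1 / 2 : ℝ) := sum_rpow_half_le _ _
      _ ≤ (K.card * (m / N)) ^ (1 / 2 : ℝ) := by
          simp_rw [div_eq_mul_inv, ← Finset.sum_mul]
          gcongr
          rw [← hsum]
          exact ENNReal.sum_le_tsum _
      _ = (2 ^ (d : ℝ) * m ^ (2 : ℝ) * (2 ^ ((d : ℝ) * l) / (m * N))) ^ (1 / 2 : ℝ) := by
          congr 1
          have h3 : (K.card : ℝ≥0∞) = 2 ^ (d : ℝ) * 2 ^ ((d : ℝ) * l) := by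
            rw [hcard, ENNReal.rpow_mul, ENNReal.rpow_natCast, ENNReal.rpow_natCast]
            push_cast
            rw [mul_pow, ← pow_mul, ← pow_mul, mul_comm d l]
          rw [h3, ENNReal.rpow_two, div_eq_mul_inv, div_eq_mul_inv,
            ENNReal.mul_inv (.inl h0) (.inl hmt)]
          calc _ = 2 ^ (d : ℝ) * 2 ^ ((d : ℝ) * l) * m * (N : ℝ≥0∞)⁻¹ * 1 := by ring
            _ = 2 ^ (d : ℝ) * 2 ^ ((d : ℝ) * l) * m * (N : ℝ≥0∞)⁻¹ * (m * m⁻¹) := by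
              rw [ENNReal.mul_inv_cancel h0 hmt]
            _ = _ := by ring
      _ = 2 ^ (d / 2 : ℝ) * m * (2 ^ ((d : ℝ) * l) / (m * N)) ^ (1 / 2 : ℝ) := by
          rw [ENNReal.mul_rpow_of_nonneg _ _ (by norm_num),
            ENNReal.mul_rpow_of_nonneg _ _ (by norm_num), ← ENNReal.rpow_mul, ← ENNReal.rpow_mul]
          norm_num
          rw [mul_one_div]
      _ ≤ _ := by
          gcongr
          · norm_num
          · linarith

lemma empMeas_apply_eq_freq {d N : ℕ} (x : Fin N → Fin d → ℝ) {s : Set (Fin d → ℝ)}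
    (hs : MeasurableSet s) : empMeas N x s = freq N s x := empMeas_apply x hs

lemma tsum_two_rpow_mul_le {d : ℕ} {p θ : ℝ} (hθ : θ ≤ 1)
    (μ : Measure (Fin d → ℝ)) [IsProbabilityMeasure μ] (l : ℕ) :
    ∑' c : ℕ × (Fin d → ℤ), 2 ^ (p * c.1) * μ (cell l ⁻¹' {c})
      ≤ ∑' n : ℕ, 2 ^ (p * n) * μ (shell ⁻¹' {n}) ^ θ := by
  rw [tsum_mul_measure_preimage μ (measurable_cell l) (fun c => (2 : ℝ≥0∞) ^ (p * c.1))]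
  simp only [cell]
  rw [← tsum_mul_measure_preimage μ measurable_shell (fun n : ℕ => (2 : ℝ≥0∞) ^ (p * n))]
  refine ENNReal.tsum_le_tsum fun n => ?_
  gcongr
  calc μ (shell ⁻¹' {n}) = μ (shell ⁻¹' {n}) ^ (1 : ℝ) := (ENNReal.rpow_one _).symm
    _ ≤ _ := ENNReal.rpow_le_rpow_of_exponent_ge prob_le_one hθ

/-- Non-asymptotic Pierce-type bound. -/
lemma exists_expWpPow_le {d : ℕ} {p : ℝ} (hp : 1 ≤ p) (hpd : 2 * p < d) :
    ∃ C : ℝ≥0∞, C ≠ ∞ ∧ ∀ (μ : Measure (Fin d → ℝ)) [IsProbabilityMeasure μ] (N : ℕ), N ≠ 0 →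
      expWpPow p μ N ≤
        C * (∑' n : ℕ, 2 ^ (p * n) * μ (shell ⁻¹' {n}) ^ (1 - p / d)) * (N : ℝ≥0∞) ^ (-(p / d)) := by
  have hd : (0 : ℝ) < d := by linarith
  have hθ : 0 < 1 - p / d := by rw [sub_pos, div_lt_one hd]; linarith
  have hθ1 : 1 - p / d ≤ 1 := by linarith [div_pos (by linarith : 0 < p) hd]
  obtain ⟨C, hC, hCle⟩ := exists_tsum_scale_le (d := d) (by linarith : 0 < p) hpd
  refine ⟨2 ^ p * 2 ^ (1 + d / 2 : ℝ) * (C + 1), by finiteness, fun μ _ N hN => ?_⟩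
  set S := ∑' n : ℕ, (2 : ℝ≥0∞) ^ (p * n) * μ (shell ⁻¹' {n}) ^ (1 - p / d) with hS
  have hN0 : (N : ℝ≥0∞) ≠ 0 := Nat.cast_ne_zero.2 hN
  have hNt : (N : ℝ≥0∞) ≠ ∞ := natCast_ne_top N
  rcases eq_or_ne S ∞ with hSt | hSt
  · rw [hSt, mul_top (by simp), top_mul]
    · exact le_top
    · exact (ENNReal.rpow_pos (by positivity) hNt).ne'
  set Q := Measure.pi fun _ : Fin N => μ
  set dev : ℕ → ℕ × (Fin d → ℤ) → (Fin N → Fin d → ℝ) → ℝ≥0∞ := fun l c x =>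
    (μ (cell l ⁻¹' {c}) - freq N (cell l ⁻¹' {c}) x)
      + (freq N (cell l ⁻¹' {c}) x - μ (cell l ⁻¹' {c})) with hdev
  have hdevm : ∀ l c, Measurable (dev l c) := fun l c => by
    have := measurable_freq N (measurable_cell (d := d) l (measurableSet_singleton c))
    fun_prop
  have hinner : ∀ n l : ℕ, ∑' k : Fin d → ℤ, ∫⁻ x, dev l (n, k) x ∂Q
      ≤ 2 ^ (1 + d / 2 : ℝ) * μ (shell ⁻¹' {n}) *
        min 1 ((2 ^ ((d : ℝ) * l) / (μ (shell ⁻¹' {n}) * N)) ^ (1 / 2 : ℝ)) := fun n l =>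
    tsum_cell_lintegral_dev_le μ hN n l
  have hE : ∑' (l : ℕ) (c : ℕ × (Fin d → ℤ)), 2 ^ (p * ((c.1 : ℝ) - l)) * ∫⁻ x, dev l c x ∂Q
      ≤ 2 ^ (1 + d / 2 : ℝ) * C * S * (N : ℝ≥0∞) ^ (-(p / d)) := by
    calc _ = ∑' (l : ℕ) (n : ℕ), 2 ^ (p * ((n : ℝ) - l)) *
            ∑' k : Fin d → ℤ, ∫⁻ x, dev l (n, k) x ∂Q := by
          simp_rw [ENNReal.tsum_prod', ENNReal.tsum_mul_left]
      _ ≤ ∑' (l : ℕ) (n : ℕ), 2 ^ (p * ((n : ℝ) - l)) * (2 ^ (1 + d / 2 : ℝ) * μ (shell ⁻¹' {n}) *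
        min 1 ((2 ^ ((d : ℝ) * l) / (μ (shell ⁻¹' {n}) * N)) ^ (1 / 2 : ℝ))) := by
          refine ENNReal.tsum_le_tsum fun l => ENNReal.tsum_le_tsum fun n => ?_
          gcongr
          exact hinner n l
      _ = ∑' (n : ℕ), 2 ^ (p * (n : ℝ)) * 2 ^ (1 + d / 2 : ℝ) * μ (shell ⁻¹' {n}) *
          ∑' l : ℕ, 2 ^ (-(p * l)) *
          min 1 ((2 ^ ((d : ℝ) * l) / (μ (shell ⁻¹' {n}) * N)) ^ (1 / 2 : ℝ)) := by
          rw [ENNReal.tsum_comm]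
          refine tsum_congr fun n => ?_
          rw [← ENNReal.tsum_mul_left]
          refine tsum_congr fun l => ?_
          rw [mul_sub, sub_eq_add_neg, ENNReal.rpow_add _ _ (by norm_num) (by norm_num)]
          ring
      _ ≤ ∑' (n : ℕ), 2 ^ (p * (n : ℝ)) * 2 ^ (1 + d / 2 : ℝ) *
          (C * μ (shell ⁻¹' {n}) ^ (1 - p / d) * (N : ℝ≥0∞) ^ (-(p / d))) := by
          refine ENNReal.tsum_le_tsum fun n => ?_
          rw [mul_assoc _ (μ _)]
          refine mul_le_mul' le_rfl ?_
          rcases eq_or_ne (μ (shell ⁻¹' {n})) 0 with h0 | h0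
          · simp [h0]
          have hmt : μ (shell ⁻¹' {n}) ≠ ∞ := measure_ne_top _ _
          refine (mul_le_mul' le_rfl (hCle _ (mul_ne_zero h0 hN0) (mul_ne_top hmt hNt))).trans
            (le_of_eq ?_)
          rw [ENNReal.mul_rpow_of_ne_top hmt hNt, sub_eq_add_neg, ENNReal.rpow_add _ _ h0 hmt,
            ENNReal.rpow_one]
          ring
      _ = _ := by
          rw [hS, ← ENNReal.tsum_mul_left, ← ENNReal.tsum_mul_right]
          refine tsum_congr fun n => ?_
          ring
  have hbound : ∀ L : ℕ, expWpPow p μ N ≤ 2 ^ (-(p * L)) * S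
      + 2 ^ p * (2 ^ (1 + d / 2 : ℝ) * C * S * (N : ℝ≥0∞) ^ (-(p / d))) := fun L => by
    calc expWpPow p μ N ≤ ∫⁻ x, (2 ^ (-(p * L)) * S + 2 ^ p *
            ∑' (l : ℕ) (c : ℕ × (Fin d → ℤ)), 2 ^ (p * ((c.1 : ℝ) - l)) * dev l c x) ∂Q := by
          refine lintegral_mono fun x => ?_
          have := isProbabilityMeasure_empMeas hN x
          refine (WpPow_le_tsum_cell hp μ (empMeas N x) (by simp) L).trans ?_
          refine add_le_add ?_ (le_of_eq ?_)
          · gcongr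
            exact tsum_two_rpow_mul_le hθ1 μ L
          · simp_rw [hdev, empMeas_apply_eq_freq x (measurable_cell _ (measurableSet_singleton _))]
      _ = 2 ^ (-(p * L)) * S + 2 ^ p * ∑' (l : ℕ) (c : ℕ × (Fin d → ℤ)),
            2 ^ (p * ((c.1 : ℝ) - l)) * ∫⁻ x, dev l c x ∂Q := by
          have hm1 : ∀ (l : ℕ) (c : ℕ × (Fin d → ℤ)), Measurable fun x =>
            (2 : ℝ≥0∞) ^ (p * ((c.1 : ℝ) - l)) * dev l c x := fun l c => (hdevm l c).const_mul _
          have hm2 : ∀ l : ℕ, Measurable fun x => ∑' c : ℕ × (Fin d → ℤ),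
            (2 : ℝ≥0∞) ^ (p * ((c.1 : ℝ) - l)) * dev l c x := fun l => .tsum (hm1 l)
          rw [lintegral_add_left measurable_const, lintegral_const, measure_univ, mul_one,
            lintegral_const_mul _ (.tsum hm2),
            lintegral_tsum fun l => (hm2 l).aemeasurable]
          congr 3 with l
          rw [lintegral_tsum fun c => (hm1 l c).aemeasurable]
          congr 1 with c
          rw [lintegral_const_mul _ (hdevm l c)]
      _ ≤ _ := by gcongr
  have hlim : Filter.Tendsto (fun L : ℕ => (2 : ℝ≥0∞) ^ (-(p * L)) * S
      + 2 ^ p * (2 ^ (1 + d / 2 : ℝ) * C * S * (N : ℝ≥0∞) ^ (-(p / d)))) Filter.atTop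
      (nhds (0 * S + 2 ^ p * (2 ^ (1 + d / 2 : ℝ) * C * S * (N : ℝ≥0∞) ^ (-(p / d))))) := by
    refine Filter.Tendsto.add_const _ (ENNReal.Tendsto.mul_const ?_ (.inr hSt))
    have h1 : (2 : ℝ≥0∞) ^ (-p) < 1 := ENNReal.rpow_lt_one_of_one_lt_of_neg (by norm_num) (by linarith)
    refine (ENNReal.tendsto_pow_atTop_nhds_zero_of_lt_one h1).congr fun L => ?_
    rw [← ENNReal.rpow_natCast, ← ENNReal.rpow_mul]
    congr 1; ring
  refine (ge_of_tendsto' hlim hbound).trans ?_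
  rw [zero_mul, zero_add]
  calc _ = 2 ^ p * 2 ^ (1 + d / 2 : ℝ) * C * S * (N : ℝ≥0∞) ^ (-(p / d)) := by ring
    _ ≤ _ := by gcongr; exact le_self_add

section

open ProbabilityTheory

lemma WpPow_zero {d : ℕ} (p : ℝ) : WpPow p (0 : Measure (Fin d → ℝ)) 0 = 0 := by
  refine le_antisymm ((WpPow_le_of_mem (ξ := 0) ⟨by simp, by simp⟩).trans (by simp)) zero_le

lemma WpPow_finsetSum_le {d : ℕ} {p : ℝ} {ι : Type*} (s : Finset ι)
    (μ ν : ι → Measure (Fin d → ℝ)) :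
    WpPow p (∑ i ∈ s, μ i) (∑ i ∈ s, ν i) ≤ ∑ i ∈ s, WpPow p (μ i) (ν i) := by
  classical
  induction s using Finset.induction_on with
  | empty => simp [WpPow_zero]
  | insert i s hi ih =>
    rw [Finset.sum_insert hi, Finset.sum_insert hi, Finset.sum_insert hi]
    exact (WpPow_add_le _ _ _ _).trans (by gcongr)

lemma pMoment_smul {d : ℕ} (p : ℝ) (c : ℝ≥0∞) (μ : Measure (Fin d → ℝ)) :
    pMoment p (c • μ) = c * pMoment p μ := lintegral_smul_measure _ _

lemma pMoment_finsetSum {d : ℕ} (p : ℝ) {ι : Type*} (s : Finset ι)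
    (μ : ι → Measure (Fin d → ℝ)) : pMoment p (∑ i ∈ s, μ i) = ∑ i ∈ s, pMoment p (μ i) :=
  lintegral_finsetSum_measure _ _ _

lemma empMeas_zero {d : ℕ} (x : Fin 0 → Fin d → ℝ) : empMeas 0 x = 0 := by
  simp [empMeas]

instance isFiniteMeasure_empMeas {d N : ℕ} (x : Fin N → Fin d → ℝ) :
    IsFiniteMeasure (empMeas N x) := by
  rcases eq_or_ne N 0 with rfl | hN
  · rw [empMeas_zero]; infer_instance
  · have := isProbabilityMeasure_empMeas hN x; infer_instance

lemma pi_sum_smul {n ι α : Type*} [Fintype n] [DecidableEq n] [Fintype ι] [MeasurableSpace α]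
    {m : ι → ℝ≥0∞} (μ : ι → Measure α) [∀ i, IsProbabilityMeasure (μ i)]
    [IsFiniteMeasure (∑ i, m i • μ i)] :
    Measure.pi (fun _ : n => ∑ i, m i • μ i)
      = ∑ κ : n → ι, (∏ j, m (κ j)) • Measure.pi fun j => μ (κ j) := by
  refine Measure.pi_eq fun s hs => ?_
  simp only [Measure.finsetSum_apply, Measure.smul_apply, smul_eq_mul, Measure.pi_pi]
  rw [Finset.prod_univ_sum, Fintype.piFinset_univ]
  simp_rw [Finset.prod_mul_distrib]

lemma map_pi_comp_injective {n n' α : Type*} [Fintype n] [Fintype n'] [MeasurableSpace α]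
    (μ : n → Measure α) [∀ j, IsProbabilityMeasure (μ j)] {g : n' → n}
    (hg : Function.Injective g) :
    (Measure.pi μ).map (fun x i => x (g i)) = Measure.pi fun i => μ (g i) := by
  have h1 : iIndepFun (fun (j : n) (x : n → α) => x j) (Measure.pi μ) :=
    iIndepFun_pi (X := fun _ => id) (fun _ => aemeasurable_id)
  have h2 := h1.precomp hg
  rw [iIndepFun_iff_map_fun_eq_pi_map (fun i => (measurable_pi_apply _).aemeasurable)] at h2
  rw [h2]
  congr 1 with i : 1
  exact (measurePreserving_eval μ (g i)).map_eq

lemma sum_freq_singleton {ι : Type*} [Fintype ι] {N : ℕ} (hN : N ≠ 0) (κ : Fin N → ι) : ∑ i, freq N {i} κ = 1 := by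
  classical
  simp_rw [freq, ← Finset.mul_sum]
  rw [Finset.sum_comm]
  have : ∀ j, ∑ i, ({i} : Set ι).indicator (1 : ι → ℝ≥0∞) (κ j) = 1 := fun j => by
    rw [Finset.sum_eq_single (κ j)] <;> simp +contextual [Set.indicator, eq_comm]
  simp_rw [this]
  simp [ENNReal.inv_mul_cancel (Nat.cast_ne_zero.2 hN) (natCast_ne_top N)]

/-- The number of indices with label `i`. -/
def labelCount {ι : Type*} [DecidableEq ι] {N : ℕ} (κ : Fin N → ι) (i : ι) : ℕ :=
  Fintype.card {j // κ j = i}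

/-- An enumeration of the indices with label `i`. -/
noncomputable def labelEnum {ι : Type*} [DecidableEq ι] {N : ℕ} (κ : Fin N → ι) (i : ι) :
    Fin (labelCount κ i) → Fin N := fun t => ((Fintype.equivFin {j // κ j = i}).symm t).1

section label

variable {ι : Type*} [DecidableEq ι] {N : ℕ}

lemma labelEnum_injective (κ : Fin N → ι) (i : ι) : Function.Injective (labelEnum κ i) :=
  Subtype.val_injective.comp (Equiv.injective _)

lemma apply_labelEnum (κ : Fin N → ι) (i : ι) (t : Fin (labelCount κ i)) :
    κ (labelEnum κ i t) = i := ((Fintype.equivFin {j // κ j = i}).symm t).2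

lemma freq_eq_labelCount (κ : Fin N → ι) (i : ι) :
    freq N {i} κ = (N : ℝ≥0∞)⁻¹ * labelCount κ i := by
  rw [freq, labelCount, Fintype.card_subtype, Finset.card_filter]
  push_cast
  congr 1
  refine Finset.sum_congr rfl fun j _ => ?_
  by_cases h : κ j = i <;> simp [h]

lemma freq_smul_empMeas_label {d : ℕ} (κ : Fin N → ι) (i : ι) (x : Fin N → Fin d → ℝ) :
    freq N {i} κ • empMeas (labelCount κ i) (fun t => x (labelEnum κ i t))
      = (N : ℝ≥0∞)⁻¹ • ∑ j with κ j = i, Measure.dirac (x j) := by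
  rw [freq_eq_labelCount]
  have hsum : ∑ t, Measure.dirac (x (labelEnum κ i t)) = ∑ j with κ j = i, Measure.dirac (x j) := by
    rw [← Finset.sum_subtype_eq_sum_filter, Finset.subtype_univ]
    exact (Fintype.equivFin {j // κ j = i}).symm.sum_comp
      fun j : {j // κ j = i} => Measure.dirac (x j.1)
  rcases eq_or_ne (labelCount κ i) 0 with h0 | h0
  · have : ∑ j with κ j = i, Measure.dirac (x j) = 0 := by
      rw [← hsum]
      exact Finset.sum_eq_zero fun t _ => absurd t.2 (by omega)
    rw [this, show (labelCount κ i : ℝ≥0∞) = 0 by simp [h0]]; simp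
  · rw [empMeas, smul_smul, mul_assoc, ENNReal.mul_inv_cancel (Nat.cast_ne_zero.2 h0)
      (natCast_ne_top _), mul_one, hsum]

lemma empMeas_eq_sum_label {d : ℕ} [Fintype ι] (κ : Fin N → ι) (x : Fin N → Fin d → ℝ) :
    empMeas N x = ∑ i, freq N {i} κ •
      empMeas (labelCount κ i) (fun t => x (labelEnum κ i t)) := by
  simp_rw [freq_smul_empMeas_label]
  rw [empMeas, ← Finset.smul_sum]
  congr 1
  exact (Finset.sum_fiberwise Finset.univ κ _).symm

lemma WpPow_mixture_le {d : ℕ} {p : ℝ} (hp : 1 ≤ p) [Fintype ι] {m : ι → ℝ≥0∞}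
    (hm : ∑ i, m i = 1) (μ : ι → Measure (Fin d → ℝ)) [∀ i, IsProbabilityMeasure (μ i)]
    (hN : N ≠ 0) (κ : Fin N → ι) (x : Fin N → Fin d → ℝ) :
    WpPow p (∑ i, m i • μ i) (empMeas N x) ≤
      ∑ i, (freq N {i} κ * WpPow p (μ i) (empMeas (labelCount κ i) fun t => x (labelEnum κ i t))
        + 2 ^ p * ((m i - freq N {i} κ) * pMoment p (μ i) + (freq N {i} κ - m i) *
          pMoment p (empMeas (labelCount κ i) fun t => x (labelEnum κ i t)))) := by
  set w : ι → ℝ≥0∞ := fun i => freq N {i} κ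
  set e : ι → Measure (Fin d → ℝ) := fun i =>
    empMeas (labelCount κ i) fun t => x (labelEnum κ i t)
  have hw : ∑ i, w i = 1 := sum_freq_singleton hN κ
  have hmt : ∀ i, m i ≠ ∞ := fun i =>
    ((Finset.single_le_sum (f := m) (fun _ _ => zero_le) (Finset.mem_univ i)).trans_lt
      (hm ▸ one_lt_top)).ne
  have hwt : ∀ i, w i ≠ ∞ := fun i =>
    ((Finset.single_le_sum (f := w) (fun _ _ => zero_le) (Finset.mem_univ i)).trans_lt
      (hw ▸ one_lt_top)).ne
  set a : ι → ℝ≥0∞ := fun i => min (m i) (w i) with ha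
  have hat : ∀ i, a i ≠ ∞ := fun i => ((min_le_left _ _).trans_lt (hmt i).lt_top).ne
  have ham : ∀ i, a i + (m i - w i) = m i := fun i => by
    rcases le_total (m i) (w i) with h | h
    · simp [ha, h, tsub_eq_zero_of_le h]
    · simp [ha, h, add_tsub_cancel_of_le]
  have haw : ∀ i, a i + (w i - m i) = w i := fun i => by
    rcases le_total (m i) (w i) with h | h
    · simp [ha, h, add_tsub_cancel_of_le]
    · simp [ha, h, tsub_eq_zero_of_le h]
  have hemp : empMeas N x = ∑ i, a i • e i + ∑ i, (w i - m i) • e i := by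
    rw [empMeas_eq_sum_label κ x, ← Finset.sum_add_distrib]
    refine Finset.sum_congr rfl fun i _ => ?_
    rw [← add_smul, haw]
  have hmu : ∑ i, m i • μ i = ∑ i, a i • μ i + ∑ i, (m i - w i) • μ i := by
    rw [← Finset.sum_add_distrib]
    refine Finset.sum_congr rfl fun i _ => ?_
    rw [← add_smul, ham]
  have he1 : ∀ i, a i * e i Set.univ = a i ∧ (w i - m i) * e i Set.univ = w i - m i := fun i => by
    rcases eq_or_ne (labelCount κ i) 0 with h0 | h0
    · have : w i = 0 := by simp only [w, freq_eq_labelCount, h0]; simp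
      simp [ha, this]
    · have : e i Set.univ = 1 := empMeas_univ h0 _
      simp [this]
  have hmass : (∑ i, (m i - w i) • μ i) Set.univ = (∑ i, (w i - m i) • e i) Set.univ := by
    have h1 : (∑ i, (m i - w i) • μ i) Set.univ = ∑ i, (m i - w i) := by simp
    have h2 : (∑ i, (w i - m i) • e i) Set.univ = ∑ i, (w i - m i) := by
      simp [fun i => (he1 i).2]
    rw [h1, h2]
    refine (ENNReal.add_right_inj (a := ∑ i, a i) (sum_ne_top.2 fun i _ => hat i)).1 ?_
    rw [← Finset.sum_add_distrib, ← Finset.sum_add_distrib]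
    simp_rw [ham, haw, hm, hw]
  have hfin1 : IsFiniteMeasure (∑ i, (m i - w i) • μ i) := ⟨by
    simpa using fun i => (tsub_le_self.trans_lt (hmt i).lt_top)⟩
  have hfin2 : IsFiniteMeasure (∑ i, (w i - m i) • e i) := ⟨by
    rw [← hmass]; exact measure_lt_top _ _⟩
  rw [hemp, hmu]
  refine (WpPow_add_le _ _ _ _).trans ?_
  rw [Finset.sum_add_distrib]
  refine add_le_add ((WpPow_finsetSum_le _ _ _).trans (Finset.sum_le_sum fun i _ => ?_)) ?_
  · refine (WpPow_smul_le _ (hat i) _ _).trans ?_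
    gcongr
    exact min_le_right _ _
  · refine (WpPow_le_pMoment hp hmass).trans ?_
    rw [← Finset.mul_sum, Finset.sum_add_distrib, pMoment_finsetSum, pMoment_finsetSum]
    simp_rw [pMoment_smul]
    exact le_rfl

end label

end

section

open ProbabilityTheory Filter

lemma measurable_pMoment_empMeas {d : ℕ} (p : ℝ) (N : ℕ) :
    Measurable fun x : Fin N → Fin d → ℝ => pMoment p (empMeas N x) := by
  simp_rw [pMoment, lintegral_empMeas _ (measurable_nnnorm_rpow p)]
  refine measurable_const.mul (Finset.measurable_sum _ fun t _ => ?_)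
  exact (measurable_nnnorm_rpow p).comp (measurable_pi_apply t)

lemma lintegral_pMoment_empMeas_le {d : ℕ} (p : ℝ) (μ : Measure (Fin d → ℝ))
    [IsProbabilityMeasure μ] (N : ℕ) :
    ∫⁻ x, pMoment p (empMeas N x) ∂(Measure.pi fun _ => μ) ≤ pMoment p μ := by
  rcases eq_or_ne N 0 with rfl | hN
  · simp [pMoment, empMeas]
  have hm : ∀ j : Fin N, Measurable fun x : Fin N → Fin d → ℝ => (‖x j‖₊ : ℝ≥0∞) ^ p := fun j =>
    (measurable_nnnorm_rpow p).comp (measurable_pi_apply j)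
  simp_rw [pMoment, lintegral_empMeas _ (measurable_nnnorm_rpow p)]
  rw [lintegral_const_mul _ (Finset.measurable_sum _ fun j _ => hm j),
    lintegral_finsetSum _ fun j _ => hm j]
  simp_rw [fun j : Fin N => (measurePreserving_eval (fun _ : Fin N => μ) j).lintegral_comp
    (measurable_nnnorm_rpow p)]
  simp [← mul_assoc, ENNReal.inv_mul_cancel (Nat.cast_ne_zero.2 hN) (natCast_ne_top N)]

section mixture

variable {ι : Type*} [Fintype ι] [DecidableEq ι] {d N : ℕ} {p : ℝ}

lemma lintegral_WpPow_mixture_le (hp : 1 ≤ p) {m : ι → ℝ≥0∞} (hm : ∑ i, m i = 1)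
    (μ : ι → Measure (Fin d → ℝ)) [∀ i, IsProbabilityMeasure (μ i)]
    (hμ : ∀ i, pMoment p (μ i) ≠ ∞) (hN : N ≠ 0) (κ : Fin N → ι) :
    ∫⁻ x, WpPow p (∑ i, m i • μ i) (empMeas N x) ∂(Measure.pi fun j => μ (κ j)) ≤
      ∑ i, (freq N {i} κ * expWpPow p (μ i) (labelCount κ i)
        + 2 ^ p * (((m i - freq N {i} κ) + (freq N {i} κ - m i)) * pMoment p (μ i))) := by
  have hmarg : ∀ i, MeasurePreserving
      (fun (x : Fin N → Fin d → ℝ) (t : Fin (labelCount κ i)) => x (labelEnum κ i t))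
      (Measure.pi fun j => μ (κ j)) (Measure.pi fun _ => μ i) := fun i => by
    refine ⟨measurable_pi_lambda _ fun t => measurable_pi_apply _, ?_⟩
    rw [map_pi_comp_injective _ (labelEnum_injective κ i)]
    simp_rw [apply_labelEnum]
  have hWm : ∀ i, Measurable fun x : Fin N → Fin d → ℝ =>
      WpPow p (μ i) (empMeas (labelCount κ i) fun t => x (labelEnum κ i t)) := fun i =>
    (measurable_WpPow_empMeas hp (μ i) (hμ i)).comp (hmarg i).measurable
  have hpm' : ∀ i, Measurable fun x : Fin N → Fin d → ℝ =>
      pMoment p (empMeas (labelCount κ i) fun t => x (labelEnum κ i t)) := fun i =>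
    (measurable_pMoment_empMeas p _).comp (hmarg i).measurable
  refine (lintegral_mono fun x => WpPow_mixture_le hp hm μ hN κ x).trans ?_
  rw [lintegral_finsetSum _ fun i _ => by have := hWm i; have := hpm' i; fun_prop]
  refine Finset.sum_le_sum fun i _ => ?_
  have h1 := hWm i
  have h2 := hpm' i
  rw [lintegral_add_left (by fun_prop), lintegral_const_mul _ h1,
    lintegral_const_mul _ (by fun_prop), lintegral_add_left measurable_const, lintegral_const, measure_univ, mul_one,
    lintegral_const_mul _ h2,
    (hmarg i).lintegral_comp (measurable_WpPow_empMeas hp (μ i) (hμ i)),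
    (hmarg i).lintegral_comp (measurable_pMoment_empMeas p _)]
  rw [expWpPow, add_mul]
  gcongr
  exact lintegral_pMoment_empMeas_le p (μ i) _

lemma expWpPow_mixture_le (hp : 1 ≤ p) [MeasurableSpace ι] [MeasurableSingletonClass ι]
    {m : ι → ℝ≥0∞} (hm : ∑ i, m i = 1)
    (μ : ι → Measure (Fin d → ℝ)) [∀ i, IsProbabilityMeasure (μ i)]
    (hμ : ∀ i, pMoment p (μ i) ≠ ∞) (hN : N ≠ 0) {θ : ℝ} (hθ0 : 0 < θ) (hθ1 : θ ≤ 1)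
    {V A : ι → ℝ≥0∞}
    (hV : ∀ i (n : ℕ), n * expWpPow p (μ i) n ≤ V i * (n : ℝ≥0∞) ^ θ + A i) :
    expWpPow p (∑ i, m i • μ i) N ≤
      ∑ i, ((N : ℝ≥0∞)⁻¹ * (V i * (N * m i) ^ θ + A i)
        + 2 ^ p * ((m i / N) ^ (1 / 2 : ℝ) * pMoment p (μ i))) := by
  have hN0 : (N : ℝ≥0∞) ≠ 0 := Nat.cast_ne_zero.2 hN
  have hNt : (N : ℝ≥0∞) ≠ ∞ := natCast_ne_top N
  set B : Measure ι := ∑ i, m i • Measure.dirac i with hB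
  have hBs : ∀ i, B {i} = m i := fun i => by
    simp only [hB, Measure.finsetSum_apply, Measure.smul_apply, smul_eq_mul]
    rw [Finset.sum_eq_single i] <;> simp +contextual
  have hBp : IsProbabilityMeasure B := ⟨by simp [hB, hm]⟩
  have hfin : IsFiniteMeasure (∑ i, m i • μ i) := ⟨by simp [hm]⟩
  rw [expWpPow, pi_sum_smul, lintegral_finsetSum_measure]
  simp_rw [lintegral_smul_measure]
  calc _ = ∫⁻ κ, (∫⁻ x, WpPow p (∑ i, m i • μ i) (empMeas N x) ∂(Measure.pi fun j => μ (κ j)))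
        ∂(Measure.pi fun _ : Fin N => B) := by
        rw [lintegral_fintype]
        refine Finset.sum_congr rfl fun κ _ => ?_
        rw [Measure.pi_singleton, smul_eq_mul, mul_comm]
        simp_rw [hBs]
    _ ≤ ∫⁻ κ, ∑ i, ((N : ℝ≥0∞)⁻¹ * (V i * (N * freq N {i} κ) ^ θ + A i)
        + 2 ^ p * (((m i - freq N {i} κ) + (freq N {i} κ - m i)) * pMoment p (μ i)))
        ∂(Measure.pi fun _ : Fin N => B) := by
        refine lintegral_mono fun κ => (lintegral_WpPow_mixture_le hp hm μ hμ hN κ).trans ?_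
        refine Finset.sum_le_sum fun i _ => ?_
        refine add_le_add ?_ le_rfl
        rw [freq_eq_labelCount, mul_assoc, ← mul_assoc (N : ℝ≥0∞), ENNReal.mul_inv_cancel hN0 hNt,
          one_mul]
        gcongr
        exact hV i _
    _ ≤ _ := by
        have hf : ∀ i, Measurable (freq N {i} : (Fin N → ι) → ℝ≥0∞) := fun i =>
          measurable_freq N (measurableSet_singleton i)
        rw [lintegral_finsetSum _ fun i _ => by have := hf i; fun_prop]
        refine Finset.sum_le_sum fun i _ => ?_
        have := hf i
        rw [lintegral_add_left (by fun_prop), lintegral_const_mul _ (by fun_prop),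
          lintegral_const_mul _ (by fun_prop), lintegral_mul_const _ (by fun_prop),
          lintegral_add_left (by fun_prop), lintegral_const, measure_univ, mul_one,
          lintegral_const_mul _ (by fun_prop)]
        have h1 := lintegral_freq_dev_le B hN (measurableSet_singleton i)
        have h2 := lintegral_rpow_le_rpow_lintegral (Measure.pi fun _ : Fin N => B)
          (f := fun κ => N * freq N {i} κ) (by fun_prop) hθ0 hθ1
        rw [lintegral_const_mul _ (by fun_prop), lintegral_freq B hN (measurableSet_singleton i)] at h2
        rw [hBs] at h1 h2
        gcongr

/-- The asymptotic normalised cost `limsup_N N ^ (p / d) * E[ρ_p^p(μ, μ̂_N)]`. -/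
noncomputable def limCost {d : ℕ} (p : ℝ) (μ : Measure (Fin d → ℝ)) : ℝ≥0∞ :=
  limsup (fun N : ℕ => (N : ℝ≥0∞) ^ (p / d) * expWpPow p μ N) atTop

lemma expWpPow_ne_top (hp : 1 ≤ p) (μ : Measure (Fin d → ℝ)) [IsProbabilityMeasure μ]
    (hμ : pMoment p μ ≠ ∞) (hN : N ≠ 0) : expWpPow p μ N ≠ ∞ := by
  have h : expWpPow p μ N ≤ ∫⁻ x, 2 ^ p * (pMoment p μ + pMoment p (empMeas N x))
      ∂(Measure.pi fun _ : Fin N => μ) := lintegral_mono fun x => by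
    have := isProbabilityMeasure_empMeas hN x
    exact WpPow_le_pMoment hp (by simp)
  have hm := measurable_pMoment_empMeas (d := d) p N
  rw [lintegral_const_mul _ (by fun_prop), lintegral_add_left measurable_const,
    lintegral_const, measure_univ, mul_one] at h
  refine (h.trans_lt (mul_lt_top (by finiteness) (add_lt_top.2 ⟨hμ.lt_top, ?_⟩))).ne
  exact (lintegral_pMoment_empMeas_le p μ N).trans_lt hμ.lt_top

lemma exists_mul_expWpPow_le (hp : 1 ≤ p) (μ : Measure (Fin d → ℝ)) [IsProbabilityMeasure μ]
    (hμ : pMoment p μ ≠ ∞) {V : ℝ≥0∞} (hV : limCost p μ < V) :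
    ∃ A : ℝ≥0∞, A ≠ ∞ ∧ ∀ n : ℕ, n * expWpPow p μ n ≤ V * (n : ℝ≥0∞) ^ (1 - p / d) + A := by
  obtain ⟨n₀, hn₀⟩ := eventually_atTop.1 (eventually_lt_of_limsup_lt hV)
  refine ⟨∑ n ∈ Finset.range n₀, n * expWpPow p μ n, sum_ne_top.2 fun n _ => ?_, fun n => ?_⟩
  · rcases eq_or_ne n 0 with rfl | hn
    · simp
    · exact mul_ne_top (natCast_ne_top n) (expWpPow_ne_top hp μ hμ hn)
  · rcases lt_or_ge n n₀ with h | h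
    · exact le_add_left (Finset.single_le_sum (f := fun n : ℕ => n * expWpPow p μ n)
        (fun _ _ => zero_le) (Finset.mem_range.2 h))
    · refine le_add_right ?_
      rcases eq_or_ne n 0 with rfl | hn
      · simp
      have hn0 : (n : ℝ≥0∞) ≠ 0 := Nat.cast_ne_zero.2 hn
      calc n * expWpPow p μ n = (n : ℝ≥0∞) ^ (1 - p / d) * ((n : ℝ≥0∞) ^ (p / d) * expWpPow p μ n) := by
            rw [← mul_assoc, ← ENNReal.rpow_add _ _ hn0 (natCast_ne_top n)]
            simp
        _ ≤ (n : ℝ≥0∞) ^ (1 - p / d) * V := by gcongr; exact (hn₀ n h).le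
        _ = _ := mul_comm _ _

lemma tendsto_natCast_rpow_neg {a : ℝ} (ha : 0 < a) :
    Tendsto (fun N : ℕ => (N : ℝ≥0∞) ^ (-a)) atTop (nhds 0) := by
  have h : Tendsto (fun N : ℕ => ((N : ℝ≥0∞)⁻¹) ^ a) atTop (nhds (0 ^ a)) :=
    (ENNReal.continuous_rpow_const.tendsto _).comp ENNReal.tendsto_inv_nat_nhds_zero
  rw [ENNReal.zero_rpow_of_pos ha] at h
  exact h.congr fun N => by rw [ENNReal.inv_rpow, ENNReal.rpow_neg]

lemma limCost_mixture_le (hp : 1 ≤ p) (hpd : 2 * p < d) [MeasurableSpace ι]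
    [MeasurableSingletonClass ι] {m : ι → ℝ≥0∞} (hm : ∑ i, m i = 1) (hm0 : ∀ i, m i ≠ 0)
    (μ : ι → Measure (Fin d → ℝ)) [∀ i, IsProbabilityMeasure (μ i)]
    (hμ : ∀ i, pMoment p (μ i) ≠ ∞) :
    limCost p (∑ i, m i • μ i) ≤ ∑ i, m i ^ (1 - p / d) * limCost p (μ i) := by
  have hd : (0 : ℝ) < d := by linarith
  have hθ : 0 < 1 - p / d := by rw [sub_pos, div_lt_one hd]; linarith
  have hθ1 : 1 - p / d ≤ 1 := by linarith [div_pos (by linarith : 0 < p) hd]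
  have hhalf : 0 < 1 / 2 - p / d := by
    rw [sub_pos, div_lt_div_iff₀ hd (by norm_num)]; linarith
  have hmt : ∀ i, m i ≠ ∞ := fun i =>
    ((Finset.single_le_sum (f := m) (fun _ _ => zero_le) (Finset.mem_univ i)).trans_lt
      (hm ▸ one_lt_top)).ne
  by_cases htop : ∃ i, limCost p (μ i) = ∞
  · obtain ⟨i, hi⟩ := htop
    have : ∑ i, m i ^ (1 - p / d) * limCost p (μ i) = ∞ := by
      refine ENNReal.sum_eq_top.2 ⟨i, Finset.mem_univ i, ?_⟩
      rw [hi, mul_top]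
      exact (ENNReal.rpow_pos (pos_iff_ne_zero.2 (hm0 i)) (hmt i)).ne'
    rw [this]; exact le_top
  push Not at htop
  have key : ∀ ε : ℝ≥0∞, ε ≠ 0 → ε ≠ ∞ →
      limCost p (∑ i, m i • μ i) ≤ ∑ i, m i ^ (1 - p / d) * (limCost p (μ i) + ε) := by
    intro ε hε hεt
    choose A hA hAle using fun i => exists_mul_expWpPow_le hp (μ i) (hμ i)
      (ENNReal.lt_add_right (htop i) hε)
    set U : ℕ → ℝ≥0∞ := fun N => ∑ i, (m i ^ (1 - p / d) * (limCost p (μ i) + ε)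
      + A i * (N : ℝ≥0∞) ^ (-(1 - p / d))
      + 2 ^ p * m i ^ (1 / 2 : ℝ) * pMoment p (μ i) * (N : ℝ≥0∞) ^ (-(1 / 2 - p / d))) with hU
    have hUlim : Tendsto U atTop (nhds (∑ i, (m i ^ (1 - p / d) * (limCost p (μ i) + ε)
        + A i * 0 + 2 ^ p * m i ^ (1 / 2 : ℝ) * pMoment p (μ i) * 0))) := by
      refine tendsto_finsetSum _ fun i _ => ?_
      have h1 := hA i
      have h2 := hμ i
      have h3 := hmt i
      refine Tendsto.add (Tendsto.add tendsto_const_nhds ?_) ?_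
      · exact ENNReal.Tendsto.const_mul (tendsto_natCast_rpow_neg hθ) (.inr h1)
      · exact ENNReal.Tendsto.const_mul (tendsto_natCast_rpow_neg hhalf)
          (.inr (mul_ne_top (mul_ne_top (by finiteness)
            (rpow_ne_top_of_nonneg (by norm_num) h3)) h2))
    simp only [mul_zero, add_zero] at hUlim
    rw [← hUlim.limsup_eq]
    refine limsup_le_limsup ?_
    filter_upwards [eventually_ne_atTop 0] with N hN
    have hN0 : (N : ℝ≥0∞) ≠ 0 := Nat.cast_ne_zero.2 hN
    have hNt : (N : ℝ≥0∞) ≠ ∞ := natCast_ne_top N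
    refine (mul_le_mul' le_rfl (expWpPow_mixture_le hp hm μ hμ hN hθ hθ1 hAle)).trans ?_
    rw [Finset.mul_sum]
    refine Finset.sum_le_sum fun i _ => le_of_eq ?_
    have e1 : (N : ℝ≥0∞) ^ (p / d) * (N : ℝ≥0∞)⁻¹ = (N : ℝ≥0∞) ^ (-(1 - p / d)) := by
      rw [← ENNReal.rpow_neg_one, ← ENNReal.rpow_add _ _ hN0 hNt]
      congr 1; ring
    have e2 : (N : ℝ≥0∞) ^ (-(1 - p / d)) * (N : ℝ≥0∞) ^ (1 - p / d) = 1 := by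
      rw [← ENNReal.rpow_add _ _ hN0 hNt]; simp
    have e3 : (N : ℝ≥0∞) ^ (p / d) * ((N : ℝ≥0∞) ^ (1 / 2 : ℝ))⁻¹
        = (N : ℝ≥0∞) ^ (-(1 / 2 - p / d)) := by
      rw [← ENNReal.rpow_neg, ← ENNReal.rpow_add _ _ hN0 hNt]
      congr 1; ring
    rw [mul_add, ← mul_assoc, e1, mul_add, ENNReal.mul_rpow_of_ne_top hNt (hmt i),
      ENNReal.div_rpow_of_nonneg _ _ (by norm_num), div_eq_mul_inv (m i ^ (1 / 2 : ℝ))]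
    calc _ = (limCost p (μ i) + ε) * m i ^ (1 - p / d) *
            ((N : ℝ≥0∞) ^ (-(1 - p / d)) * (N : ℝ≥0∞) ^ (1 - p / d))
          + A i * (N : ℝ≥0∞) ^ (-(1 - p / d)) + 2 ^ p * m i ^ (1 / 2 : ℝ) * pMoment p (μ i) *
            ((N : ℝ≥0∞) ^ (p / d) * ((N : ℝ≥0∞) ^ (1 / 2 : ℝ))⁻¹) := by ring
      _ = _ := by rw [e2, e3]; ring
  have hlim : Tendsto (fun n : ℕ => ∑ i, m i ^ (1 - p / d) * (limCost p (μ i) + (n : ℝ≥0∞)⁻¹))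
      atTop (nhds (∑ i, m i ^ (1 - p / d) * (limCost p (μ i) + 0))) := by
    refine tendsto_finsetSum _ fun i _ => ENNReal.Tendsto.const_mul
      (tendsto_const_nhds.add ENNReal.tendsto_inv_nat_nhds_zero) (.inr ?_)
    exact rpow_ne_top_of_nonneg hθ.le (hmt i)
  simp only [add_zero] at hlim
  refine ge_of_tendsto hlim ?_
  filter_upwards [eventually_ne_atTop 0] with n hn
  exact key _ (by simp) (by simpa using hn)

end mixture

/-- The asymptotic cost of a finite measure, extended from probability measures so that it is
homogeneous of degree `1 - p / d` in the mass. -/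
noncomputable def massCost {d : ℕ} (p : ℝ) (ν : Measure (Fin d → ℝ)) : ℝ≥0∞ :=
  ν Set.univ ^ (1 - p / d) * limCost p ((ν Set.univ)⁻¹ • ν)

section massCost

variable {d : ℕ} {p : ℝ}

lemma one_sub_div_pos (hpd : p < d) (hp : 0 < p) : 0 < 1 - p / d := by
  have hd : (0 : ℝ) < d := by linarith
  rw [sub_pos, div_lt_one hd]; linarith

lemma massCost_zero (hpd : p < d) (hp : 0 < p) : massCost p (0 : Measure (Fin d → ℝ)) = 0 := by
  simp [massCost, ENNReal.zero_rpow_of_pos (one_sub_div_pos hpd hp)]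

lemma massCost_eq_limCost (μ : Measure (Fin d → ℝ)) [IsProbabilityMeasure μ] :
    massCost p μ = limCost p μ := by simp [massCost]

lemma isProbabilityMeasure_inv_smul {α : Type*} [MeasurableSpace α] {ν : Measure α}
    [IsFiniteMeasure ν] (h : ν ≠ 0) : IsProbabilityMeasure ((ν Set.univ)⁻¹ • ν) := ⟨by
  simpa using ENNReal.inv_mul_cancel (by simpa using h) (measure_ne_top ν _)⟩

lemma massCost_add_le (hp : 1 ≤ p) (hpd : 2 * p < d) (ν₁ ν₂ : Measure (Fin d → ℝ))
    [IsFiniteMeasure ν₁] [IsFiniteMeasure ν₂] (h₁ : pMoment p ν₁ ≠ ∞) (h₂ : pMoment p ν₂ ≠ ∞) :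
    massCost p (ν₁ + ν₂) ≤ massCost p ν₁ + massCost p ν₂ := by
  have hd : p < d := by linarith
  have hp0 : 0 < p := by linarith
  have hθ := one_sub_div_pos hd hp0
  rcases eq_or_ne ν₁ 0 with rfl | h10
  · simp
  rcases eq_or_ne ν₂ 0 with rfl | h20
  · simp
  set M := (ν₁ + ν₂) Set.univ with hM
  have hM0 : M ≠ 0 := by simp [hM, h10]
  have hMt : M ≠ ∞ := measure_ne_top _ _
  set ν : Bool → Measure (Fin d → ℝ) := fun b => bif b then ν₁ else ν₂ with hν
  have hfin : ∀ b, IsFiniteMeasure (ν b) := by rintro (_ | _) <;> simp only [hν, cond_true, cond_false] <;> infer_instance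
  have hν0 : ∀ b, ν b ≠ 0 := by rintro (_ | _) <;> simpa [hν]
  have hνm : ∀ b, pMoment p (ν b) ≠ ∞ := by rintro (_ | _) <;> simpa [hν]
  have hm0 : ∀ b, ν b Set.univ ≠ 0 := fun b => by simpa using hν0 b
  have hprob : ∀ b, IsProbabilityMeasure ((ν b Set.univ)⁻¹ • ν b) := fun b =>
    isProbabilityMeasure_inv_smul (hν0 b)
  have hmix := limCost_mixture_le hp hpd (m := fun b => M⁻¹ * ν b Set.univ)
    (by
      simp only [Fintype.sum_bool, ← mul_add]
      exact ENNReal.inv_mul_cancel hM0 hMt)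
    (fun b => mul_ne_zero (ENNReal.inv_ne_zero.2 hMt) (hm0 b))
    (fun b => (ν b Set.univ)⁻¹ • ν b)
    (fun b => by
      rw [pMoment_smul]
      exact mul_ne_top (ENNReal.inv_ne_top.2 (hm0 b)) (hνm b))
  have hcancel : ∀ b, (M⁻¹ * ν b Set.univ) • (ν b Set.univ)⁻¹ • ν b = M⁻¹ • ν b := fun b => by
    rw [smul_smul, mul_assoc, ENNReal.mul_inv_cancel (hm0 b) (measure_ne_top _ _), mul_one]
  simp_rw [hcancel, ENNReal.mul_rpow_of_ne_top (ENNReal.inv_ne_top.2 hM0)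
    (measure_ne_top _ _), mul_assoc, ← Finset.mul_sum, ENNReal.inv_rpow, ← Finset.smul_sum] at hmix
  calc massCost p (ν₁ + ν₂) = M ^ (1 - p / d) * limCost p (M⁻¹ • ∑ b, ν b) := by
        simp [massCost, hν, hM]
    _ ≤ M ^ (1 - p / d) * ((M ^ (1 - p / d))⁻¹ *
        ∑ b, ν b Set.univ ^ (1 - p / d) * limCost p ((ν b Set.univ)⁻¹ • ν b)) := by gcongr
    _ = ∑ b, ν b Set.univ ^ (1 - p / d) * limCost p ((ν b Set.univ)⁻¹ • ν b) := by
        rw [← mul_assoc, ENNReal.mul_inv_cancel, one_mul]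
        · exact (ENNReal.rpow_pos (pos_iff_ne_zero.2 hM0) hMt).ne'
        · exact rpow_ne_top_of_nonneg hθ.le hMt
    _ = _ := by simp [massCost, hν]

lemma massCost_finsetSum_le (hp : 1 ≤ p) (hpd : 2 * p < d) {ι : Type*} (s : Finset ι)
    (ν : ι → Measure (Fin d → ℝ)) [∀ i, IsFiniteMeasure (ν i)] (h : ∀ i, pMoment p (ν i) ≠ ∞) :
    massCost p (∑ i ∈ s, ν i) ≤ ∑ i ∈ s, massCost p (ν i) := by
  classical
  induction s using Finset.induction_on with
  | empty => simp [massCost_zero (by linarith : p < d) (by linarith)]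
  | insert i s hi ih =>
    rw [Finset.sum_insert hi, Finset.sum_insert hi]
    refine (massCost_add_le hp hpd _ _ (h i) ?_).trans (by gcongr)
    rw [pMoment_finsetSum]
    exact sum_ne_top.2 fun i _ => h i

lemma exists_massCost_le (hp : 1 ≤ p) (hpd : 2 * p < d) :
    ∃ C : ℝ≥0∞, C ≠ ∞ ∧ ∀ (ν : Measure (Fin d → ℝ)) [IsFiniteMeasure ν],
      massCost p ν ≤ C * ∑' n : ℕ, 2 ^ (p * n) * ν (shell ⁻¹' {n}) ^ (1 - p / d) := by
  have hθ := one_sub_div_pos (by linarith : p < d) (by linarith)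
  obtain ⟨C, hC, hle⟩ := exists_expWpPow_le (d := d) hp hpd
  refine ⟨C, hC, fun ν _ => ?_⟩
  rcases eq_or_ne ν 0 with rfl | h0
  · simp [massCost_zero (by linarith : p < d) (by linarith)]
  have hM0 : ν Set.univ ≠ 0 := by simpa using h0
  have hMt : ν Set.univ ≠ ∞ := measure_ne_top _ _
  have hM0' : ν Set.univ ^ (1 - p / d) ≠ 0 := (ENNReal.rpow_pos (pos_iff_ne_zero.2 hM0) hMt).ne'
  have hMt' : ν Set.univ ^ (1 - p / d) ≠ ∞ := rpow_ne_top_of_nonneg hθ.le hMt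
  have := isProbabilityMeasure_inv_smul h0
  set S := ∑' n : ℕ, (2 : ℝ≥0∞) ^ (p * n) * ν (shell ⁻¹' {n}) ^ (1 - p / d) with hS
  have hlim : limCost p ((ν Set.univ)⁻¹ • ν) ≤ C * ((ν Set.univ ^ (1 - p / d))⁻¹ * S) := by
    refine limsup_le_of_le (by isBoundedDefault) ?_
    filter_upwards [eventually_ne_atTop 0] with N hN
    have hN0 : (N : ℝ≥0∞) ≠ 0 := Nat.cast_ne_zero.2 hN
    refine (mul_le_mul' le_rfl (hle _ N hN)).trans (le_of_eq ?_)
    rw [mul_comm, mul_assoc, ← ENNReal.rpow_add _ _ hN0 (natCast_ne_top N)]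
    simp only [neg_add_cancel, ENNReal.rpow_zero, mul_one, Measure.smul_apply, smul_eq_mul]
    congr 1
    rw [hS, ← ENNReal.tsum_mul_left]
    refine tsum_congr fun n => ?_
    rw [ENNReal.mul_rpow_of_ne_top (ENNReal.inv_ne_top.2 hM0) (measure_ne_top _ _),
      ENNReal.inv_rpow]
    ring
  calc massCost p ν ≤ ν Set.univ ^ (1 - p / d) * (C * ((ν Set.univ ^ (1 - p / d))⁻¹ * S)) :=
        mul_le_mul' le_rfl hlim
    _ = C * S * (ν Set.univ ^ (1 - p / d) * (ν Set.univ ^ (1 - p / d))⁻¹) := by ring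
    _ = C * S := by rw [ENNReal.mul_inv_cancel hM0' hMt', mul_one]

lemma expWpPow_map_le (hp : 0 ≤ p) (a : Fin d → ℝ) {s : ℝ} (hs : 0 < s)
    (μ : Measure (Fin d → ℝ)) [IsProbabilityMeasure μ] (N : ℕ) :
    expWpPow p (μ.map fun x => a + s • x) N ≤ ENNReal.ofReal s ^ p * expWpPow p μ N := by
  have hT : Measurable fun x : Fin d → ℝ => a + s • x := by fun_prop
  have hT' : Measurable fun (x : Fin N → Fin d → ℝ) j => a + s • x j := by fun_prop
  have := Measure.isProbabilityMeasure_map (μ := μ) hT.aemeasurable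
  have hpi : (Measure.pi fun _ : Fin N => μ.map fun x => a + s • x)
      = (Measure.pi fun _ : Fin N => μ).map fun x j => a + s • x j :=
    (Measure.pi_map_pi (fun _ => hT.aemeasurable)).symm
  have hemp : ∀ x : Fin N → Fin d → ℝ, empMeas N (fun j => a + s • x j)
      = (empMeas N x).map fun x => a + s • x := fun x => by
    rw [empMeas, empMeas, Measure.map_smul]
    congr 1
    rw [← Measure.mapₗ_apply_of_measurable hT, map_sum]
    refine Finset.sum_congr rfl fun j _ => ?_
    rw [Measure.mapₗ_apply_of_measurable hT]
    exact (Measure.map_dirac' hT (x j)).symm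
  rw [expWpPow, hpi]
  refine (lintegral_map_le _ _).trans ?_
  rw [expWpPow, ← lintegral_const_mul' _ _ (by finiteness)]
  refine lintegral_mono fun x => ?_
  rw [hemp]
  exact WpPow_map_le hp a hs _ _

lemma massCost_map_le (hp : 0 < p) (hpd : p < d) (a : Fin d → ℝ) {s : ℝ} (hs : 0 < s)
    (ν : Measure (Fin d → ℝ)) [IsFiniteMeasure ν] :
    massCost p (ν.map fun x => a + s • x) ≤ ENNReal.ofReal s ^ p * massCost p ν := by
  rcases eq_or_ne ν 0 with rfl | h0
  · simp [massCost_zero hpd hp]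
  have := isProbabilityMeasure_inv_smul h0
  have hT : Measurable fun x : Fin d → ℝ => a + s • x := by fun_prop
  rw [massCost, Measure.map_apply hT .univ, Set.preimage_univ, ← Measure.map_smul, massCost,
    mul_left_comm]
  gcongr
  rw [limCost, limCost, ← ENNReal.limsup_const_mul_of_ne_top (by finiteness)]
  refine limsup_le_limsup (Eventually.of_forall fun N => ?_)
  dsimp only
  rw [mul_left_comm]
  gcongr
  exact expWpPow_map_le hp.le a hs _ N

end massCost

section grid

variable {d : ℕ} {p : ℝ}

/-- The index of the cube of side `2 ^ (-l)` of the regular grid containing `x`. -/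
noncomputable def gridIdx (l : ℕ) (x : Fin d → ℝ) : Fin d → ℤ := fun i => ⌊2 ^ l * x i⌋

/-- The half-open grid cube of side `2 ^ (-l)` with index `k`. -/
def gridCube (l : ℕ) (k : Fin d → ℤ) : Set (Fin d → ℝ) := gridIdx l ⁻¹' {k}

lemma measurable_gridIdx (l : ℕ) : Measurable (gridIdx (d := d) l) :=
  measurable_pi_lambda _ fun i => Int.measurable_floor.comp
    (measurable_const.mul (measurable_pi_apply i))

lemma measurableSet_gridCube (l : ℕ) (k : Fin d → ℤ) : MeasurableSet (gridCube l k) :=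
  measurable_gridIdx l (measurableSet_singleton k)

/-- The affine map taking the unit cube to the grid cube with index `k`. -/
noncomputable def gridMap (l : ℕ) (k : Fin d → ℤ) (x : Fin d → ℝ) : Fin d → ℝ :=
  (fun i => (2 ^ l : ℝ)⁻¹ * k i) + (2 ^ l : ℝ)⁻¹ • x

lemma measurable_gridMap (l : ℕ) (k : Fin d → ℤ) : Measurable (gridMap l k) := by
  unfold gridMap; fun_prop

/-- The inverse of `gridMap`. -/
noncomputable def gridMapInv (l : ℕ) (k : Fin d → ℤ) (x : Fin d → ℝ) : Fin d → ℝ :=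
  (2 ^ l : ℝ) • x - fun i => (k i : ℝ)

lemma measurable_gridMapInv (l : ℕ) (k : Fin d → ℤ) : Measurable (gridMapInv l k) := by
  unfold gridMapInv; fun_prop

lemma gridMap_gridMapInv (l : ℕ) (k : Fin d → ℤ) (x : Fin d → ℝ) :
    gridMap l k (gridMapInv l k x) = x := by
  ext i
  simp only [gridMap, gridMapInv, Pi.add_apply, Pi.smul_apply, Pi.sub_apply, smul_eq_mul]
  field_simp; ring

lemma gridMap_preimage_gridCube (l : ℕ) (k : Fin d → ℤ) :
    gridMap l k ⁻¹' gridCube l k = unitBox d := by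
  ext x
  simp only [gridCube, gridIdx, gridMap, unitBox, Set.mem_preimage, Set.mem_singleton_iff,
    Set.mem_univ_pi, funext_iff, Int.floor_eq_iff, Pi.add_apply, Pi.smul_apply, smul_eq_mul,
    Set.mem_Ico]
  refine forall_congr' fun i => ?_
  have : (2 : ℝ) ^ l * ((2 ^ l)⁻¹ * k i + (2 ^ l)⁻¹ * x i) = k i + x i := by field_simp
  rw [this]
  constructor <;> rintro ⟨h1, h2⟩ <;> constructor <;> linarith

lemma gridMapInv_mem_unitBox {l : ℕ} {k : Fin d → ℤ} {x : Fin d → ℝ} (hx : x ∈ gridCube l k) :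
    gridMapInv l k x ∈ unitBox d := by
  rw [← gridMap_preimage_gridCube l k, Set.mem_preimage, gridMap_gridMapInv]
  exact hx

lemma volume_unitBox (d : ℕ) : volume (unitBox d) = 1 := by
  simp [unitBox, volume_pi_pi]

lemma shell_eq_zero_of_mem_unitBox {x : Fin d → ℝ} (hx : x ∈ unitBox d) : shell x = 0 := by
  refine shell_eq_zero_of_norm_lt ((pi_norm_lt_iff one_pos).2 fun i => ?_)
  obtain ⟨h1, h2⟩ := hx i trivial
  rw [Real.norm_eq_abs, abs_lt]
  constructor <;> linarith

lemma map_gridMap_volume (l : ℕ) (k : Fin d → ℤ) :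
    (volume : Measure (Fin d → ℝ)).map (gridMap l k) = ((2 : ℝ≥0∞) ^ ((l : ℝ) * d)) • volume := by
  have h1 : gridMap l k = (fun x => (fun i => (2 ^ l : ℝ)⁻¹ * k i) + x) ∘
    fun x => (2 ^ l : ℝ)⁻¹ • x := rfl
  rw [h1, ← Measure.map_map (by fun_prop) (by fun_prop), Measure.map_addHaar_smul _ (by positivity),
    Measure.map_smul, map_add_left_eq_self]
  congr 1
  rw [Module.finrank_fin_fun, inv_pow, inv_inv, abs_of_pos (by positivity), ENNReal.ofReal_pow
    (by positivity), ENNReal.ofReal_pow (by norm_num), ENNReal.rpow_mul, ENNReal.rpow_natCast,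
    ENNReal.rpow_natCast]
  simp

lemma map_gridMap_restrict (l : ℕ) (k : Fin d → ℤ) :
    ((volume : Measure (Fin d → ℝ)).restrict (unitBox d)).map (gridMap l k)
      = ((2 : ℝ≥0∞) ^ ((l : ℝ) * d)) • volume.restrict (gridCube l k) := by
  rw [← gridMap_preimage_gridCube l k, ← Measure.restrict_map (measurable_gridMap l k)
    (measurableSet_gridCube l k), map_gridMap_volume, Measure.restrict_smul]

lemma volume_gridCube (l : ℕ) (k : Fin d → ℤ) :
    volume (gridCube l k) = (2 : ℝ≥0∞) ^ (-((l : ℝ) * d)) := by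
  have h := congrArg (fun ν => ν Set.univ) (map_gridMap_restrict l k)
  simp only [Measure.map_apply (measurable_gridMap l k) .univ, Set.preimage_univ,
    Measure.restrict_apply_univ, Measure.smul_apply, smul_eq_mul, volume_unitBox] at h
  rw [ENNReal.rpow_neg]
  exact ENNReal.eq_inv_of_mul_eq_one_left ((mul_comm _ _).trans h.symm)

lemma massCost_smul_prob (hp : 0 < p) (hpd : p < d) {c : ℝ≥0∞} (hc : c ≠ ∞)
    (μ : Measure (Fin d → ℝ)) [IsProbabilityMeasure μ] :
    massCost p (c • μ) = c ^ (1 - p / d) * limCost p μ := by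
  rcases eq_or_ne c 0 with rfl | h0
  · simp [massCost_zero hpd hp, ENNReal.zero_rpow_of_pos (one_sub_div_pos hpd hp)]
  · simp [massCost, smul_smul, ENNReal.inv_mul_cancel h0 hc]

instance isProbabilityMeasure_unitBox :
    IsProbabilityMeasure ((volume : Measure (Fin d → ℝ)).restrict (unitBox d)) :=
  ⟨by simp [volume_unitBox]⟩

lemma ofReal_two_pow_inv_rpow (hd : (d : ℝ) ≠ 0) (l : ℕ) (k : Fin d → ℤ) :
    ENNReal.ofReal ((2 ^ l : ℝ)⁻¹) ^ p = volume (gridCube l k) ^ (p / d) := by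
  rw [volume_gridCube, ← ENNReal.rpow_mul, ENNReal.ofReal_inv_of_pos (by positivity),
    ENNReal.ofReal_pow (by norm_num), ← ENNReal.rpow_natCast, ← ENNReal.rpow_neg,
    ← ENNReal.rpow_mul]
  simp only [ofReal_ofNat]
  congr 1
  field_simp

/-- Asymptotic cost of a multiple of Lebesgue measure on a cube. -/
lemma massCost_smul_gridCube_le (hp : 0 < p) (hpd : p < d) {c : ℝ≥0∞} (hc : c ≠ ∞) (l : ℕ)
    (k : Fin d → ℤ) :
    massCost p (c • (volume : Measure (Fin d → ℝ)).restrict (gridCube l k)) ≤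
      limCost p ((volume : Measure (Fin d → ℝ)).restrict (unitBox d)) *
        (c ^ (1 - p / d) * volume (gridCube l k)) := by
  have hθ := one_sub_div_pos hpd hp
  have hd : (0 : ℝ) < d := by linarith
  set v := volume (gridCube l k) with hv
  have hv0 : v ≠ 0 := by
    rw [hv, volume_gridCube]
    exact (ENNReal.rpow_pos (by norm_num) (by norm_num)).ne'
  have hvt : v ≠ ∞ := by rw [hv, volume_gridCube]; finiteness
  have heq : c • (volume : Measure (Fin d → ℝ)).restrict (gridCube l k)
      = ((c * v) • (volume : Measure (Fin d → ℝ)).restrict (unitBox d)).map (gridMap l k) := by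
    rw [Measure.map_smul, map_gridMap_restrict, smul_smul, mul_assoc, hv, volume_gridCube,
      ← ENNReal.rpow_add _ _ (by norm_num) (by norm_num)]
    simp
  rw [heq]
  have hfin : IsFiniteMeasure ((c * v) • (volume : Measure (Fin d → ℝ)).restrict (unitBox d)) :=
    Measure.smul_finite _ (mul_ne_top hc hvt)
  refine (massCost_map_le hp hpd _ (by positivity) _).trans (le_of_eq ?_)
  rw [massCost_smul_prob hp hpd (mul_ne_top hc hvt), ofReal_two_pow_inv_rpow hd.ne' l k, ← hv,
    ENNReal.mul_rpow_of_ne_top hc hvt]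
  have : v ^ (p / d) * v ^ (1 - p / d) = v := by
    rw [← ENNReal.rpow_add _ _ hv0 hvt]; simp
  calc _ = (v ^ (p / d) * v ^ (1 - p / d)) * c ^ (1 - p / d) *
        limCost p ((volume : Measure (Fin d → ℝ)).restrict (unitBox d)) := by ring
    _ = _ := by rw [this]; ring

/-- Asymptotic cost of an arbitrary finite measure carried by a cube. -/
lemma massCost_restrict_gridCube_le (hp : 0 < p) (hpd : p < d) {C : ℝ≥0∞}
    (hC : ∀ (ν : Measure (Fin d → ℝ)) [IsFiniteMeasure ν],
      massCost p ν ≤ C * ∑' n : ℕ, 2 ^ (p * n) * ν (shell ⁻¹' {n}) ^ (1 - p / d))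
    (ν : Measure (Fin d → ℝ)) [IsFiniteMeasure ν] (l : ℕ) (k : Fin d → ℤ) :
    massCost p (ν.restrict (gridCube l k)) ≤
      C * (volume (gridCube l k) ^ (p / d) * ν (gridCube l k) ^ (1 - p / d)) := by
  have hθ := one_sub_div_pos hpd hp
  have hd : (0 : ℝ) < d := by linarith
  set ρ := (ν.restrict (gridCube l k)).map (gridMapInv l k) with hρ
  have heq : ν.restrict (gridCube l k) = ρ.map (gridMap l k) := by
    rw [hρ, Measure.map_map (measurable_gridMap l k) (measurable_gridMapInv l k)]
    have : gridMap l k ∘ gridMapInv l k = id := funext fun x => gridMap_gridMapInv l k x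
    rw [this, Measure.map_id]
  have hshell : ∀ n : ℕ, n ≠ 0 → ρ (shell ⁻¹' {n}) = 0 := fun n hn => by
    rw [hρ, Measure.map_apply (measurable_gridMapInv l k) (measurable_shell
      (measurableSet_singleton n)), Measure.restrict_apply (measurable_gridMapInv l k
      (measurable_shell (measurableSet_singleton n)))]
    have : gridMapInv l k ⁻¹' (shell ⁻¹' {n}) ∩ gridCube l k = ∅ := by
      refine Set.eq_empty_iff_forall_notMem.2 fun x hx => hn ?_
      rw [← shell_eq_zero_of_mem_unitBox (gridMapInv_mem_unitBox hx.2)]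
      exact hx.1.symm
    rw [this, measure_empty]
  have hmass : ρ Set.univ = ν (gridCube l k) := by
    rw [hρ, Measure.map_apply (measurable_gridMapInv l k) .univ]; simp
  rw [heq]
  refine (massCost_map_le hp hpd _ (by positivity) _).trans ?_
  rw [ofReal_two_pow_inv_rpow hd.ne' l k, mul_left_comm]
  refine mul_le_mul' le_rfl ((hC ρ).trans (mul_le_mul' le_rfl ?_))
  rw [tsum_eq_single 0 (fun n hn => by rw [hshell n hn, ENNReal.zero_rpow_of_pos hθ, mul_zero])]
  simp only [CharP.cast_eq_zero, mul_zero, ENNReal.rpow_zero, one_mul]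
  rw [← hmass]
  gcongr
  exact Set.subset_univ _

end grid

section approximation

variable {d : ℕ} {p : ℝ}

/-- The indices of the grid cubes of side `2 ^ (-l)` contained in `[-2 ^ l, 2 ^ l) ^ d`. -/
noncomputable def gridBox (d l : ℕ) : Finset (Fin d → ℤ) :=
  Fintype.piFinset fun _ => Finset.Ico (-4 ^ l) (4 ^ l)

lemma eventually_gridIdx_mem_gridBox (x : Fin d → ℝ) :
    ∀ᶠ l in atTop, gridIdx l x ∈ gridBox d l := by
  filter_upwards [eventually_ge_atTop (shell x)] with l hl
  refine Fintype.mem_piFinset.2 fun i => Finset.mem_Ico.2 ?_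
  have h1 : |x i| < 2 ^ l := (norm_le_pi_norm x i).trans_lt
    ((norm_lt_two_pow_shell x).trans_le (pow_le_pow_right₀ (by norm_num) hl))
  obtain ⟨h2, h3⟩ := abs_lt.1 h1
  have h4 : (4 : ℝ) ^ l = 2 ^ l * 2 ^ l := by rw [← mul_pow]; norm_num
  have h5 : (0 : ℝ) < 2 ^ l := by positivity
  refine ⟨Int.le_floor.2 ?_, Int.floor_lt.2 ?_⟩ <;> push_cast <;> rw [h4] <;> nlinarith

lemma dist_le_of_mem_gridCube {l : ℕ} {x y : Fin d → ℝ} (h : y ∈ gridCube l (gridIdx l x)) :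
    dist y x ≤ (2⁻¹ : ℝ) ^ l := by
  refine (dist_pi_le_iff (by positivity)).2 fun i => ?_
  have h1 := Int.abs_sub_lt_one_of_floor_eq_floor (congrFun (Set.mem_singleton_iff.1 h) i)
  rw [← mul_sub, abs_mul, abs_of_pos (by positivity : (0 : ℝ) < 2 ^ l)] at h1
  rw [Real.dist_eq, inv_pow, ← one_div, le_div_iff₀ (by positivity), mul_comm]
  exact h1.le

lemma eventually_gridCube_subset {U : Set (Fin d → ℝ)} (hU : IsOpen U) {x : Fin d → ℝ}
    (hx : x ∈ U) : ∀ᶠ l in atTop, gridCube l (gridIdx l x) ⊆ U := by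
  obtain ⟨ε, hε, hb⟩ := Metric.isOpen_iff.1 hU x hx
  have ht : Tendsto (fun l : ℕ => (2⁻¹ : ℝ) ^ l) atTop (nhds 0) :=
    tendsto_pow_atTop_nhds_zero_of_lt_one (by norm_num) (by norm_num)
  filter_upwards [ht.eventually_lt_const hε] with l hl y hy
  exact hb ((dist_le_of_mem_gridCube hy).trans_lt hl)

lemma mem_gridCube_gridIdx (l : ℕ) (x : Fin d → ℝ) : x ∈ gridCube l (gridIdx l x) := rfl

lemma gridCube_nonempty (l : ℕ) (k : Fin d → ℤ) : (gridCube l k).Nonempty := by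
  have h : (fun _ => 0 : Fin d → ℝ) ∈ gridMap l k ⁻¹' gridCube l k := by
    rw [gridMap_preimage_gridCube]
    exact fun i _ => ⟨le_rfl, one_pos⟩
  exact ⟨_, h⟩

lemma sum_indicator_gridCube (s : Finset (Fin d → ℤ)) (g : (Fin d → ℤ) → ℝ≥0∞) (l : ℕ)
    (x : Fin d → ℝ) : ∑ k ∈ s, (gridCube l k).indicator (fun _ => g k) x
      = if gridIdx l x ∈ s then g (gridIdx l x) else 0 := by
  classical
  simp [Set.indicator_apply, gridCube]

lemma IsStepFun.integrable {g : (Fin d → ℝ) → ℝ} (hg : IsStepFun g) : Integrable g := by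
  obtain ⟨n, c, B, hB, rfl⟩ := hg
  refine integrable_finsetSum _ fun i _ => Integrable.const_mul ?_ _
  obtain ⟨a, b, h⟩ := hB i
  rw [h]
  refine (integrable_indicator_iff (.univ_pi fun _ => measurableSet_Ico)).2 ?_
  refine integrableOn_const (C := (1 : ℝ)) ?_
  rw [volume_pi_pi]
  exact ENNReal.prod_ne_top fun i _ => by simp

lemma IsStepFun.measurable {g : (Fin d → ℝ) → ℝ} (hg : IsStepFun g) : Measurable g := by
  obtain ⟨n, c, B, hB, rfl⟩ := hg
  refine Finset.measurable_sum _ fun i _ => Measurable.const_mul ?_ _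
  obtain ⟨a, b, h⟩ := hB i
  rw [h]
  exact measurable_one.indicator (.univ_pi fun _ => measurableSet_Ico)

lemma IsStepFun.ae_eventually_const {g : (Fin d → ℝ) → ℝ} (hg : IsStepFun g) :
    ∀ᵐ x, ∀ᶠ l in atTop, ∀ y ∈ gridCube l (gridIdx l x), g y = g x := by
  obtain ⟨n, c, B, hB, rfl⟩ := hg
  have h : ∀ i, ∀ᵐ x, x ∉ frontier (B i) := fun i => by
    obtain ⟨a, b, h⟩ := hB i
    have : Convex ℝ (B i) := h ▸ convex_pi fun _ _ => convex_Ico _ _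
    exact measure_eq_zero_iff_ae_notMem.1 (this.addHaar_frontier volume)
  filter_upwards [ae_all_iff.2 h] with x hx
  have h2 : ∀ i, ∀ᶠ l in atTop, ∀ y ∈ gridCube l (gridIdx l x),
      (B i).indicator (1 : (Fin d → ℝ) → ℝ) y = (B i).indicator 1 x := fun i => by
    by_cases hi : x ∈ interior (B i)
    · filter_upwards [eventually_gridCube_subset isOpen_interior hi] with l hl y hy
      rw [Set.indicator_of_mem (interior_subset (hl hy)), Set.indicator_of_mem
        (interior_subset hi)]
      rfl
    · have hc : x ∉ closure (B i) := fun hc => hx i ⟨hc, hi⟩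
      filter_upwards [eventually_gridCube_subset isClosed_closure.isOpen_compl hc] with l hl y hy
      rw [Set.indicator_of_notMem fun hy' => hl hy (subset_closure hy'),
        Set.indicator_of_notMem fun hy' => hc (subset_closure hy')]
  filter_upwards [eventually_all.2 h2] with l hl y hy
  exact Finset.sum_congr rfl fun i _ => by rw [hl i y hy]

/-- The infimum of a function over a grid cube. -/
noncomputable def cubeInf (f : (Fin d → ℝ) → ℝ) (l : ℕ) (k : Fin d → ℤ) : ℝ≥0∞ :=
  ⨅ y ∈ gridCube l k, ENNReal.ofReal (f y)

lemma cubeInf_le (f : (Fin d → ℝ) → ℝ) (l : ℕ) (x : Fin d → ℝ) :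
    cubeInf f l (gridIdx l x) ≤ ENNReal.ofReal (f x) :=
  iInf₂_le x (mem_gridCube_gridIdx l x)

lemma cubeInf_ne_top (f : (Fin d → ℝ) → ℝ) (l : ℕ) (k : Fin d → ℤ) : cubeInf f l k ≠ ∞ := by
  obtain ⟨x, rfl⟩ := gridCube_nonempty l k
  exact ((cubeInf_le f l x).trans_lt ofReal_lt_top).ne

/-- The lower Darboux approximation of a function on the grid of generation `l`. -/
noncomputable def lowerStep (f : (Fin d → ℝ) → ℝ) (l : ℕ) (x : Fin d → ℝ) : ℝ≥0∞ :=
  if gridIdx l x ∈ gridBox d l then cubeInf f l (gridIdx l x) else 0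

lemma measurable_lowerStep (f : (Fin d → ℝ) → ℝ) (l : ℕ) : Measurable (lowerStep f l) :=
  (measurable_of_countable fun k => if k ∈ gridBox d l then cubeInf f l k else 0).comp
    (measurable_gridIdx l)

lemma lowerStep_le (f : (Fin d → ℝ) → ℝ) (l : ℕ) (x : Fin d → ℝ) :
    lowerStep f l x ≤ ENNReal.ofReal (f x) := by
  unfold lowerStep
  split_ifs
  exacts [cubeInf_le f l x, zero_le]

lemma withDensity_lowerStep (f : (Fin d → ℝ) → ℝ) (l : ℕ) :
    volume.withDensity (lowerStep f l)
      = ∑ k ∈ gridBox d l, cubeInf f l k • volume.restrict (gridCube l k) := by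
  ext s hs
  rw [withDensity_apply _ hs, Measure.finsetSum_apply]
  have : ∀ x, lowerStep f l x
      = ∑ k ∈ gridBox d l, (gridCube l k).indicator (fun _ => cubeInf f l k) x := fun x =>
    (sum_indicator_gridCube _ _ l x).symm
  simp_rw [this]
  rw [lintegral_finsetSum _ fun k _ => measurable_const.indicator (measurableSet_gridCube l k)]
  refine Finset.sum_congr rfl fun k _ => ?_
  rw [lintegral_indicator_const (measurableSet_gridCube l k),
    Measure.restrict_apply (measurableSet_gridCube l k), Measure.smul_apply,
    Measure.restrict_apply hs, Set.inter_comm, smul_eq_mul]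

lemma sum_cubeInf_rpow_le (f : (Fin d → ℝ) → ℝ) {θ : ℝ} (hθ : 0 ≤ θ) (l : ℕ) :
    ∑ k ∈ gridBox d l, cubeInf f l k ^ θ * volume (gridCube l k)
      ≤ ∫⁻ x, ENNReal.ofReal (f x) ^ θ := by
  calc ∑ k ∈ gridBox d l, cubeInf f l k ^ θ * volume (gridCube l k)
      = ∫⁻ x, ∑ k ∈ gridBox d l, (gridCube l k).indicator (fun _ => cubeInf f l k ^ θ) x := by
        rw [lintegral_finsetSum _ fun k _ => measurable_const.indicator
          (measurableSet_gridCube l k)]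
        exact Finset.sum_congr rfl fun k _ =>
          (lintegral_indicator_const (measurableSet_gridCube l k) _).symm
    _ ≤ _ := lintegral_mono fun x => by
        rw [sum_indicator_gridCube]
        split_ifs
        exacts [ENNReal.rpow_le_rpow (cubeInf_le f l x) hθ, zero_le]

lemma ae_restrict_tendsto_lowerStep {f : (Fin d → ℝ) → ℝ} (hf : RiemannIntegrableOnCubes f)
    {B : Set (Fin d → ℝ)} (hB : IsBox B) :
    ∀ᵐ x, x ∈ interior B →
      Tendsto (fun l => lowerStep f l x) atTop (nhds (ENNReal.ofReal (f x))) := by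
  choose g h hg hh hgh hint using fun n : ℕ => hf B hB (1 / ((n : ℝ) + 1)) (by positivity)
  have hBm : MeasurableSet B := by
    obtain ⟨a, b, rfl⟩ := hB
    exact .univ_pi fun _ => measurableSet_Ico
  have hmeas : ∀ n, Measurable fun x => ENNReal.ofReal (h n x - g n x) := fun n =>
    ((hh n).measurable.sub (hg n).measurable).ennreal_ofReal
  have hle : ∀ n : ℕ, ∫⁻ x in B, ⨅ n, ENNReal.ofReal (h n x - g n x)
      ≤ ENNReal.ofReal (1 / ((n : ℝ) + 1)) := fun n => by
    refine (lintegral_mono fun x => iInf_le _ n).trans ?_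
    rw [← ofReal_integral_eq_lintegral_ofReal]
    · exact ENNReal.ofReal_le_ofReal (hint n).le
    · exact ((hh n).integrable.sub (hg n).integrable).integrableOn
    · exact (ae_restrict_iff' hBm).2 (.of_forall fun x hx => sub_nonneg.2
        ((hgh n x hx).1.trans (hgh n x hx).2))
  have hzero : ∫⁻ x in B, ⨅ n, ENNReal.ofReal (h n x - g n x) = 0 := by
    have ht : Tendsto (fun n : ℕ => ENNReal.ofReal (1 / ((n : ℝ) + 1))) atTop (nhds 0) := by
      simpa using ENNReal.tendsto_ofReal (tendsto_one_div_add_atTop_nhds_zero_nat (𝕜 := ℝ))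
    exact le_antisymm (ge_of_tendsto' ht hle) zero_le
  rw [lintegral_eq_zero_iff (.iInf hmeas), EventuallyEq, ae_restrict_iff' hBm] at hzero
  filter_upwards [hzero, ae_all_iff.2 fun n => (hg n).ae_eventually_const] with x hx hconst hxB
  have hxB' := interior_subset hxB
  refine tendsto_of_le_liminf_of_limsup_le ?_ ?_
  · have hn : ∀ n, ENNReal.ofReal (f x)
        ≤ liminf (fun l => lowerStep f l x) atTop + ENNReal.ofReal (h n x - g n x) := fun n => by
      have h1 : ENNReal.ofReal (g n x) ≤ liminf (fun l => lowerStep f l x) atTop := by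
        refine le_liminf_of_le (by isBoundedDefault) ?_
        filter_upwards [hconst n, eventually_gridIdx_mem_gridBox x,
          eventually_gridCube_subset isOpen_interior hxB] with l h1 h2 h3
        rw [lowerStep, if_pos h2]
        refine le_iInf₂ fun y hy => ENNReal.ofReal_le_ofReal ?_
        rw [← h1 y hy]
        exact (hgh n y (interior_subset (h3 hy))).1
      calc ENNReal.ofReal (f x) ≤ ENNReal.ofReal (g n x + (h n x - g n x)) :=
            ENNReal.ofReal_le_ofReal (by linarith [(hgh n x hxB').2])
        _ ≤ _ := ENNReal.ofReal_add_le
        _ ≤ _ := by gcongr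
    calc ENNReal.ofReal (f x)
        ≤ ⨅ n, (liminf (fun l => lowerStep f l x) atTop + ENNReal.ofReal (h n x - g n x)) :=
          le_iInf hn
      _ = _ := by rw [← ENNReal.add_iInf, show (⨅ n, ENNReal.ofReal (h n x - g n x)) = 0 from
          hx hxB', add_zero]
  · exact limsup_le_of_le (by isBoundedDefault) (.of_forall fun l => lowerStep_le f l x)

lemma ae_tendsto_lowerStep {f : (Fin d → ℝ) → ℝ} (hf : RiemannIntegrableOnCubes f) :
    ∀ᵐ x, Tendsto (fun l => lowerStep f l x) atTop (nhds (ENNReal.ofReal (f x))) := by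
  filter_upwards [ae_all_iff.2 fun m : ℕ => ae_restrict_tendsto_lowerStep hf
    ⟨fun _ => -(m : ℝ), fun _ => (m : ℝ), rfl⟩] with x hx
  obtain ⟨m, hm⟩ := exists_nat_gt ‖x‖
  refine hx m (mem_interior.2 ⟨Metric.ball 0 m, fun y hy i _ => ?_, Metric.isOpen_ball, by simpa⟩)
  have := abs_lt.1 ((norm_le_pi_norm y i).trans_lt (mem_ball_zero_iff.1 hy))
  exact ⟨this.1.le, this.2⟩

lemma RiemannIntegrableOnCubes.aemeasurable_ofReal {f : (Fin d → ℝ) → ℝ}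
    (hf : RiemannIntegrableOnCubes f) : AEMeasurable fun x => ENNReal.ofReal (f x) :=
  aemeasurable_of_tendsto_metrizable_ae atTop
    (fun l => (measurable_lowerStep f l).aemeasurable) (ae_tendsto_lowerStep hf)

end approximation

section decomposition

variable {d : ℕ} {p : ℝ}

open scoped Classical in
/-- The indices in `gridBox d l` of the grid cubes contained in `U`. -/
noncomputable def innerCubes (U : Set (Fin d → ℝ)) (l : ℕ) : Finset (Fin d → ℤ) :=
  (gridBox d l).filter fun k => gridCube l k ⊆ U

/-- The union of the grid cubes with index in `innerCubes U l`. -/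
def innerUnion (U : Set (Fin d → ℝ)) (l : ℕ) : Set (Fin d → ℝ) :=
  gridIdx l ⁻¹' (innerCubes U l)

lemma measurableSet_innerUnion (U : Set (Fin d → ℝ)) (l : ℕ) :
    MeasurableSet (innerUnion U l) :=
  measurable_gridIdx l (Finset.measurableSet _)

lemma innerUnion_subset (U : Set (Fin d → ℝ)) (l : ℕ) : innerUnion U l ⊆ U := fun x hx => by
  classical
  exact (Finset.mem_filter.1 (Finset.mem_coe.1 hx)).2 (mem_gridCube_gridIdx l x)

lemma sum_measure_gridCube (ν : Measure (Fin d → ℝ)) (s : Finset (Fin d → ℤ)) (l : ℕ)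
    {A : Set (Fin d → ℝ)} (hA : MeasurableSet A) :
    ∑ k ∈ s, ν (A ∩ gridCube l k) = ν (A ∩ gridIdx l ⁻¹' s) := by
  have h : A ∩ gridIdx l ⁻¹' s = ⋃ k ∈ s, A ∩ gridCube l k := by
    ext x; simp [gridCube]
  rw [h, measure_biUnion_finset _ fun k _ => hA.inter (measurableSet_gridCube l k)]
  intro i _ j _ hij
  refine Set.disjoint_left.2 fun x hx hx' => hij ?_
  exact (Set.mem_singleton_iff.1 hx.2).symm.trans (Set.mem_singleton_iff.1 hx'.2)

lemma restrict_innerUnion (ν : Measure (Fin d → ℝ)) (U : Set (Fin d → ℝ)) (l : ℕ) :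
    ν.restrict (innerUnion U l) = ∑ k ∈ innerCubes U l, ν.restrict (gridCube l k) := by
  ext A hA
  rw [Measure.finsetSum_apply, Measure.restrict_apply hA, innerUnion,
    ← sum_measure_gridCube ν _ l hA]
  exact Finset.sum_congr rfl fun k _ => (Measure.restrict_apply hA).symm

lemma tendsto_measure_compl_innerUnion (ν : Measure (Fin d → ℝ)) [IsFiniteMeasure ν]
    {U : Set (Fin d → ℝ)} (hU : IsOpen U) (hν : ν Uᶜ = 0) :
    Tendsto (fun l => ν (innerUnion U l)ᶜ) atTop (nhds 0) := by
  classical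
  rw [← hν]
  refine tendsto_measure_of_ae_tendsto_indicator_of_isFiniteMeasure _ hU.measurableSet.compl
    (fun l => (measurableSet_innerUnion U l).compl) (.of_forall fun x => ?_)
  by_cases hx : x ∈ U
  · filter_upwards [eventually_gridCube_subset hU hx, eventually_gridIdx_mem_gridBox x]
      with l h1 h2
    have : x ∈ innerUnion U l := Finset.mem_coe.2 (Finset.mem_filter.2 ⟨h2, h1⟩)
    simp [this, hx]
  · exact .of_forall fun l => by simp [hx, mt (@innerUnion_subset _ U l x) hx]

lemma sum_rpow_mul_rpow_le {ι : Type*} (s : Finset ι) (v m : ι → ℝ≥0∞) {t : ℝ} (h0 : 0 < t)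
    (h1 : t < 1) :
    ∑ i ∈ s, v i ^ t * m i ^ (1 - t) ≤ (∑ i ∈ s, v i) ^ t * (∑ i ∈ s, m i) ^ (1 - t) := by
  have h1' : 0 < 1 - t := by linarith
  have hpq : Real.HolderConjugate (1 / t) (1 / (1 - t)) :=
    Real.holderConjugate_iff.2 ⟨by rw [lt_div_iff₀ h0]; linarith, by simp⟩
  refine (ENNReal.inner_le_Lp_mul_Lq s _ _ hpq).trans (le_of_eq ?_)
  simp_rw [one_div_one_div, ← ENNReal.rpow_mul, mul_one_div_cancel h0.ne',
    mul_one_div_cancel h1'.ne', ENNReal.rpow_one]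

lemma sum_innerCubes_le (hp : 0 < p) (hpd : p < d) (ν : Measure (Fin d → ℝ)) {U : Set (Fin d → ℝ)}
    {ε : ℝ≥0∞} (hU : volume U ≤ ε) (l : ℕ) :
    ∑ k ∈ innerCubes U l, volume (gridCube l k) ^ (p / d) * ν (gridCube l k) ^ (1 - p / d)
      ≤ ε ^ (p / d) * ν Set.univ ^ (1 - p / d) := by
  have hd : (0 : ℝ) < d := by linarith
  have hθ := one_sub_div_pos hpd hp
  have hsum : ∀ ν : Measure (Fin d → ℝ), ∑ k ∈ innerCubes U l, ν (gridCube l k)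
      = ν (innerUnion U l) := fun ν => by
    simpa [innerUnion] using sum_measure_gridCube ν (innerCubes U l) l .univ
  refine (sum_rpow_mul_rpow_le _ _ _ (div_pos hp hd) (by linarith)).trans ?_
  rw [hsum, hsum]
  gcongr
  exacts [(measure_mono (innerUnion_subset U l)).trans hU, Set.subset_univ _]

/-- The part of a measure that is not captured by the grid of generation `l`. -/
noncomputable def remainder (f : (Fin d → ℝ) → ℝ) (μs : Measure (Fin d → ℝ))
    (U : Set (Fin d → ℝ)) (l : ℕ) : Measure (Fin d → ℝ) :=
  volume.withDensity (fun x => ENNReal.ofReal (f x) - lowerStep f l x)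
    + μs.restrict (innerUnion U l)ᶜ

lemma grid_decomposition (f : (Fin d → ℝ) → ℝ) (μs : Measure (Fin d → ℝ)) (U : Set (Fin d → ℝ))
    (l : ℕ) : volume.withDensity (fun x => ENNReal.ofReal (f x)) + μs
      = ∑ k ∈ gridBox d l, cubeInf f l k • volume.restrict (gridCube l k)
        + ∑ k ∈ innerCubes U l, μs.restrict (gridCube l k) + remainder f μs U l := by
  have h1 : (fun x => ENNReal.ofReal (f x))
      = lowerStep f l + fun x => ENNReal.ofReal (f x) - lowerStep f l x :=
    funext fun x => (add_tsub_cancel_of_le (lowerStep_le f l x)).symm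
  conv_lhs => rw [h1, withDensity_add_left (measurable_lowerStep f l), withDensity_lowerStep,
    ← Measure.restrict_add_restrict_compl (μ := μs) (measurableSet_innerUnion U l),
    restrict_innerUnion]
  rw [remainder]
  abel

lemma tendsto_remainder_univ {f : (Fin d → ℝ) → ℝ} (hf : RiemannIntegrableOnCubes f)
    (hfi : ∫⁻ x, ENNReal.ofReal (f x) ≠ ∞) (μs : Measure (Fin d → ℝ)) [IsFiniteMeasure μs]
    {U : Set (Fin d → ℝ)} (hU : IsOpen U) (hμU : μs Uᶜ = 0) :
    Tendsto (fun l => remainder f μs U l Set.univ) atTop (nhds 0) := by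
  have h : Tendsto (fun l => ∫⁻ x, (ENNReal.ofReal (f x) - lowerStep f l x)) atTop
      (nhds (∫⁻ _ : Fin d → ℝ, 0)) := by
    refine tendsto_lintegral_of_dominated_convergence' (fun x => ENNReal.ofReal (f x))
      (fun l => hf.aemeasurable_ofReal.sub (measurable_lowerStep f l).aemeasurable)
      (fun l => .of_forall fun x => tsub_le_self) hfi ?_
    filter_upwards [ae_tendsto_lowerStep hf] with x hx
    simpa using ENNReal.Tendsto.sub (tendsto_const_nhds (x := ENNReal.ofReal (f x))) hx
      (.inl ofReal_ne_top)
  simpa [remainder] using h.add (tendsto_measure_compl_innerUnion μs hU hμU)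

lemma smul_restrict_gridCube_le (f : (Fin d → ℝ) → ℝ) (l : ℕ) (k : Fin d → ℤ) :
    cubeInf f l k • (volume : Measure (Fin d → ℝ)).restrict (gridCube l k)
      ≤ volume.withDensity fun x => ENNReal.ofReal (f x) := by
  refine Measure.le_iff.2 fun A hA => ?_
  rw [withDensity_apply _ hA, Measure.smul_apply, smul_eq_mul, Measure.restrict_apply hA,
    Set.inter_comm, ← Measure.restrict_apply (measurableSet_gridCube l k),
    ← lintegral_indicator_const (measurableSet_gridCube l k)]
  refine lintegral_mono (Set.indicator_le' (fun y hy => ?_) fun _ _ => zero_le)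
  exact iInf₂_le y hy

lemma pMoment_mono {ν μ : Measure (Fin d → ℝ)} (h : ν ≤ μ) : pMoment p ν ≤ pMoment p μ :=
  lintegral_mono' h le_rfl

/-- The asymptotic cost of a measure is at most that of its absolutely continuous part up to
a small multiple of a weighted sum over shells of the remainder. -/
lemma massCost_le_add_remainder (hp : 1 ≤ p) (hpd : 2 * p < d) {C : ℝ≥0∞}
    (hC : ∀ (ν : Measure (Fin d → ℝ)) [IsFiniteMeasure ν],
      massCost p ν ≤ C * ∑' n : ℕ, 2 ^ (p * n) * ν (shell ⁻¹' {n}) ^ (1 - p / d))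
    {μ μs : Measure (Fin d → ℝ)} [IsFiniteMeasure μ] (hμ : pMoment p μ ≠ ∞)
    {f : (Fin d → ℝ) → ℝ} (hdecomp : μ = volume.withDensity (fun x => ENNReal.ofReal (f x)) + μs)
    {U : Set (Fin d → ℝ)} {ε : ℝ≥0∞} (hU : volume U ≤ ε) (l : ℕ) :
    massCost p μ ≤ limCost p ((volume : Measure (Fin d → ℝ)).restrict (unitBox d)) *
        (∫⁻ x, ENNReal.ofReal (f x) ^ (1 - p / d)) + C * (ε ^ (p / d) * μs Set.univ ^ (1 - p / d))
      + C * ∑' n : ℕ, 2 ^ (p * n) * remainder f μs U l (shell ⁻¹' {n}) ^ (1 - p / d) := by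
  have hp0 : 0 < p := by linarith
  have hpd' : p < d := by linarith
  have hdec := hdecomp.trans (grid_decomposition f μs U l)
  have hle₁ : ∀ k, cubeInf f l k • (volume : Measure (Fin d → ℝ)).restrict (gridCube l k) ≤ μ :=
    fun k => (smul_restrict_gridCube_le f l k).trans (hdecomp ▸ Measure.le_add_right le_rfl)
  have hμs : μs ≤ μ := hdecomp ▸ Measure.le_add_left le_rfl
  have hle₂ : ∀ k, μs.restrict (gridCube l k) ≤ μ := fun k => Measure.restrict_le_self.trans hμs
  have hle₃ : remainder f μs U l ≤ μ := hdec ▸ Measure.le_add_left le_rfl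
  have hfin {ν : Measure (Fin d → ℝ)} (h : ν ≤ μ) : pMoment p ν ≠ ∞ :=
    ((pMoment_mono h).trans_lt hμ.lt_top).ne
  have i₁ := fun k => isFiniteMeasure_of_le μ (hle₁ k)
  have i₂ := fun k => isFiniteMeasure_of_le μ (hle₂ k)
  have i₃ := isFiniteMeasure_of_le μ hle₃
  have i₄ := isFiniteMeasure_of_le μ hμs
  have hle₁₂ : ∑ k ∈ gridBox d l, cubeInf f l k • volume.restrict (gridCube l k)
      + ∑ k ∈ innerCubes U l, μs.restrict (gridCube l k) ≤ μ := hdec ▸ Measure.le_add_right le_rfl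
  have hle₁' : ∑ k ∈ gridBox d l, cubeInf f l k • volume.restrict (gridCube l k) ≤ μ :=
    (Measure.le_add_right le_rfl).trans hle₁₂
  have hle₂' : ∑ k ∈ innerCubes U l, μs.restrict (gridCube l k) ≤ μ :=
    (Measure.le_add_left le_rfl).trans hle₁₂
  have i₁₂ := isFiniteMeasure_of_le μ hle₁₂
  have i₁' := isFiniteMeasure_of_le μ hle₁'
  have i₂' := isFiniteMeasure_of_le μ hle₂'
  conv_lhs => rw [hdec]
  refine (massCost_add_le hp hpd _ _ (hfin hle₁₂) (hfin hle₃)).trans (add_le_add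
    ((massCost_add_le hp hpd _ _ (hfin hle₁') (hfin hle₂')).trans (add_le_add ?_ ?_)) (hC _))
  · refine (massCost_finsetSum_le hp hpd _ _ fun k => hfin (hle₁ k)).trans ?_
    refine (Finset.sum_le_sum fun k _ => massCost_smul_gridCube_le hp0 hpd'
      (cubeInf_ne_top f l k) l k).trans ?_
    rw [← Finset.mul_sum]
    gcongr
    exact sum_cubeInf_rpow_le f (one_sub_div_pos hpd' hp0).le l
  · refine (massCost_finsetSum_le hp hpd _ _ fun k => hfin (hle₂ k)).trans ?_
    refine (Finset.sum_le_sum fun k _ => massCost_restrict_gridCube_le hp0 hpd' hC μs l k).trans ?_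
    rw [← Finset.mul_sum]
    gcongr
    exact sum_innerCubes_le hp0 hpd' μs hU l

end decomposition

section moments

variable {d : ℕ} {p q : ℝ}

lemma pMoment_ne_top_of_le (hp : 0 ≤ p) (hpq : p ≤ q) {μ : Measure (Fin d → ℝ)}
    [IsFiniteMeasure μ] (hμ : pMoment q μ ≠ ∞) : pMoment p μ ≠ ∞ := by
  have h : pMoment p μ ≤ ∫⁻ x, (1 + (‖x‖₊ : ℝ≥0∞) ^ q) ∂μ := by
    refine lintegral_mono fun x => ?_
    rcases le_total (‖x‖₊ : ℝ≥0∞) 1 with h | h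
    · exact (ENNReal.rpow_le_one h hp).trans le_self_add
    · exact (ENNReal.rpow_le_rpow_of_exponent_le h hpq).trans le_add_self
  refine (h.trans_lt ?_).ne
  rw [lintegral_add_left measurable_const]
  exact add_lt_top.2 ⟨by simp, hμ.lt_top⟩

lemma measure_shell_succ_le (hq : 0 ≤ q) (μ : Measure (Fin d → ℝ)) (n : ℕ) :
    μ (shell ⁻¹' {n + 1}) ≤ pMoment q μ * (2 ^ (-q)) ^ n := by
  have hsub : shell ⁻¹' {n + 1} ⊆ {x : Fin d → ℝ | (2 : ℝ≥0∞) ^ (n * q) ≤ (‖x‖₊ : ℝ≥0∞) ^ q} := by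
    intro x hx
    have h := two_pow_le_norm_of_shell (Set.mem_singleton_iff.1 hx)
    have h' : (2 : ℝ≥0∞) ^ n ≤ (‖x‖₊ : ℝ≥0∞) := by
      simpa [ENNReal.ofReal_pow, ← enorm_eq_nnnorm] using ENNReal.ofReal_le_ofReal h
    rw [Set.mem_ofPred_eq, ENNReal.rpow_mul, ENNReal.rpow_natCast]
    exact ENNReal.rpow_le_rpow h' hq
  have hne : (2 : ℝ≥0∞) ^ (n * q) ≠ 0 := (ENNReal.rpow_pos (by norm_num) (by norm_num)).ne'
  have := (measure_mono hsub).trans (meas_ge_le_lintegral_div (μ := μ)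
    (measurable_nnnorm_rpow q).aemeasurable hne (by finiteness))
  refine this.trans (le_of_eq ?_)
  rw [pMoment, ENNReal.div_eq_inv_mul, mul_comm, ← ENNReal.rpow_neg, ← ENNReal.rpow_natCast,
    ← ENNReal.rpow_mul]
  ring_nf

lemma tsum_shell_ne_top {θ : ℝ} (hq : 0 < q) (hθ : 0 < θ) (hpq : p < q * θ)
    (μ : Measure (Fin d → ℝ)) [IsFiniteMeasure μ] (hμ : pMoment q μ ≠ ∞) :
    ∑' n : ℕ, (2 : ℝ≥0∞) ^ (p * n) * μ (shell ⁻¹' {n}) ^ θ ≠ ∞ := by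
  rw [tsum_eq_zero_add' ENNReal.summable]
  refine add_ne_top.2 ⟨by finiteness, ?_⟩
  have h : ∀ n : ℕ, (2 : ℝ≥0∞) ^ (p * (n + 1 : ℕ)) * μ (shell ⁻¹' {n + 1}) ^ θ
      ≤ 2 ^ p * pMoment q μ ^ θ * (2 ^ (p - q * θ)) ^ n := fun n => by
    calc _ ≤ (2 : ℝ≥0∞) ^ (p * (n + 1 : ℕ)) * (pMoment q μ * (2 ^ (-q)) ^ n) ^ θ := by
          gcongr
          exact measure_shell_succ_le hq.le μ n
      _ = 2 ^ p * pMoment q μ ^ θ * (2 ^ (p * n) * 2 ^ (-q * n * θ)) := by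
          rw [ENNReal.mul_rpow_of_nonneg _ _ hθ.le, ← ENNReal.rpow_natCast, ← ENNReal.rpow_mul,
            ← ENNReal.rpow_mul, show p * (n + 1 : ℕ) = p + p * n by push_cast; ring,
            ENNReal.rpow_add _ _ (by norm_num) (by norm_num)]
          ring_nf
      _ = _ := by
          rw [← ENNReal.rpow_add _ _ (by norm_num) (by norm_num), ← ENNReal.rpow_natCast,
            ← ENNReal.rpow_mul]
          ring_nf
  refine ((ENNReal.tsum_le_tsum h).trans_lt ?_).ne
  rw [ENNReal.tsum_mul_left, ENNReal.tsum_geometric]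
  refine mul_lt_top (mul_lt_top (by finiteness) (rpow_lt_top_of_nonneg hθ.le hμ)) ?_
  refine inv_lt_top.2 (tsub_pos_of_lt ?_)
  exact ENNReal.rpow_lt_one_of_one_lt_of_neg (by norm_num) (by linarith)

lemma tsum_shell_le {θ θ' : ℝ} (hθ' : 0 ≤ θ') (hθ : θ' ≤ θ) {ν μ : Measure (Fin d → ℝ)}
    (hν : ν ≤ μ) :
    ∑' n : ℕ, (2 : ℝ≥0∞) ^ (p * n) * ν (shell ⁻¹' {n}) ^ θ
      ≤ ν Set.univ ^ (θ - θ') * ∑' n : ℕ, (2 : ℝ≥0∞) ^ (p * n) * μ (shell ⁻¹' {n}) ^ θ' := by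
  rw [← ENNReal.tsum_mul_left]
  refine ENNReal.tsum_le_tsum fun n => ?_
  rw [mul_left_comm]
  gcongr
  calc ν (shell ⁻¹' {n}) ^ θ = ν (shell ⁻¹' {n}) ^ (θ - θ') * ν (shell ⁻¹' {n}) ^ θ' := by
        rw [← ENNReal.rpow_add_of_nonneg _ _ (by linarith) hθ', sub_add_cancel]
    _ ≤ _ := by
        gcongr
        exact Set.subset_univ _

end moments

section final

variable {d : ℕ} {p q : ℝ}

lemma tendsto_tsum_shell_remainder (hp : 1 ≤ p) (hpd : p < d) (hq : d * p / (d - p) < q)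
    {μ μs : Measure (Fin d → ℝ)} [IsFiniteMeasure μ] [IsFiniteMeasure μs] (hμ : pMoment q μ ≠ ∞)
    {f : (Fin d → ℝ) → ℝ} (hf : RiemannIntegrableOnCubes f)
    (hfi : ∫⁻ x, ENNReal.ofReal (f x) ≠ ∞) {U : Set (Fin d → ℝ)} (hU : IsOpen U)
    (hμU : μs Uᶜ = 0) (hle : ∀ l, remainder f μs U l ≤ μ) :
    Tendsto (fun l => ∑' n : ℕ, (2 : ℝ≥0∞) ^ (p * n) *
      remainder f μs U l (shell ⁻¹' {n}) ^ (1 - p / d)) atTop (nhds 0) := by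
  have hd : (0 : ℝ) < d := by linarith
  have hdp : (0 : ℝ) < d - p := by linarith
  have hq0 : 0 < q := lt_trans (by positivity) hq
  have hpq : p / q < 1 - p / d := by
    rw [div_lt_iff₀ hdp] at hq
    rw [div_lt_iff₀ hq0, one_sub_div hd.ne', div_mul_eq_mul_div, lt_div_iff₀ hd]
    linarith
  obtain ⟨θ', h1, h2⟩ := exists_between hpq
  have hθ' : 0 < θ' := lt_trans (by positivity) h1
  have hT := tsum_shell_ne_top (p := p) hq0 hθ' ((div_lt_iff₀' hq0).1 h1) μ hμ
  have hlim := ENNReal.Tendsto.mul_const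
    (b := ∑' n : ℕ, (2 : ℝ≥0∞) ^ (p * n) * μ (shell ⁻¹' {n}) ^ θ')
    ((tendsto_remainder_univ hf hfi μs hU hμU).ennrpow_const (1 - p / d - θ')) (.inr hT)
  rw [ENNReal.zero_rpow_of_pos (by linarith), zero_mul] at hlim
  exact tendsto_of_tendsto_of_tendsto_of_le_of_le tendsto_const_nhds hlim (fun _ => zero_le)
    fun l => tsum_shell_le hθ'.le h2.le (hle l)

lemma limCost_le (hp : 1 ≤ p) (hpd : 2 * p < d) (hq : d * p / (d - p) < q)
    {μ μs : Measure (Fin d → ℝ)} [IsProbabilityMeasure μ] (hμ : pMoment q μ ≠ ∞)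
    {f : (Fin d → ℝ) → ℝ} (hf : RiemannIntegrableOnCubes f) (hsing : μs ⟂ₘ volume)
    (hdecomp : μ = volume.withDensity (fun x => ENNReal.ofReal (f x)) + μs) :
    limCost p μ ≤ limCost p ((volume : Measure (Fin d → ℝ)).restrict (unitBox d)) *
        ∫⁻ x, ENNReal.ofReal (f x) ^ (1 - p / d) := by
  have hp0 : 0 < p := by linarith
  have hpd' : p < d := by linarith
  have hd : (0 : ℝ) < d := by linarith
  have hθ := one_sub_div_pos hpd' hp0
  obtain ⟨C, hCtop, hC⟩ := exists_massCost_le (d := d) hp hpd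
  have hpq : p ≤ q := by
    refine le_trans ?_ hq.le
    rw [le_div_iff₀ (by linarith)]
    nlinarith
  have hμp := pMoment_ne_top_of_le hp0.le hpq hμ
  have hμs : μs ≤ μ := hdecomp ▸ Measure.le_add_left le_rfl
  have := isFiniteMeasure_of_le μ hμs
  have hfi : ∫⁻ x, ENNReal.ofReal (f x) ≠ ∞ := by
    rw [← setLIntegral_univ, ← withDensity_apply _ .univ]
    have h : volume.withDensity (fun x => ENNReal.ofReal (f x)) ≤ μ :=
      hdecomp ▸ Measure.le_add_right le_rfl
    exact ((h Set.univ).trans_lt (measure_lt_top μ _)).ne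
  obtain ⟨s, -, hs1, hs2⟩ := hsing
  rw [← massCost_eq_limCost μ]
  have key : ∀ n : ℕ, massCost p μ ≤
      limCost p ((volume : Measure (Fin d → ℝ)).restrict (unitBox d)) *
        (∫⁻ x, ENNReal.ofReal (f x) ^ (1 - p / d)) +
      C * ((n : ℝ≥0∞)⁻¹ ^ (p / d) * μs Set.univ ^ (1 - p / d)) := fun n => by
    obtain ⟨U, hsU, hUo, hUε⟩ := Set.exists_isOpen_lt_of_lt (μ := volume) sᶜ (n : ℝ≥0∞)⁻¹
      (by rw [hs2]; simp)
    have hμU : μs Uᶜ = 0 := measure_mono_null (Set.compl_subset_comm.1 hsU) hs1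
    have hlim := tendsto_tsum_shell_remainder hp hpd' hq hμ hf hfi hUo hμU fun l => by
      conv_rhs => rw [hdecomp, grid_decomposition f μs U l]
      exact Measure.le_add_left le_rfl
    have h2 := (ENNReal.Tendsto.const_mul hlim (.inr hCtop)).const_add
      (limCost p ((volume : Measure (Fin d → ℝ)).restrict (unitBox d)) *
        (∫⁻ x, ENNReal.ofReal (f x) ^ (1 - p / d)) +
      C * ((n : ℝ≥0∞)⁻¹ ^ (p / d) * μs Set.univ ^ (1 - p / d)))
    rw [mul_zero, add_zero] at h2
    exact ge_of_tendsto' h2 fun l => massCost_le_add_remainder hp hpd hC hμp hdecomp hUε.le l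
  have h1 := ENNReal.Tendsto.mul_const (b := μs Set.univ ^ (1 - p / d))
    (ENNReal.tendsto_inv_nat_nhds_zero.ennrpow_const (p / d)) (.inr (by finiteness))
  have h2 := (ENNReal.Tendsto.const_mul h1 (.inr hCtop)).const_add
    (limCost p ((volume : Measure (Fin d → ℝ)).restrict (unitBox d)) *
        ∫⁻ x, ENNReal.ofReal (f x) ^ (1 - p / d))
  rw [ENNReal.zero_rpow_of_pos (by positivity), zero_mul, mul_zero, add_zero] at h2
  exact ge_of_tendsto' h2 key

lemma natCast_rpow_mul_rpow (hp : 0 < p) (μ : Measure (Fin d → ℝ)) (N : ℕ) :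
    (N : ℝ≥0∞) ^ ((d : ℝ)⁻¹) * expWpPow p μ N ^ (1 / p)
      = ((N : ℝ≥0∞) ^ (p / d) * expWpPow p μ N) ^ (1 / p) := by
  rw [ENNReal.mul_rpow_of_nonneg _ _ (by positivity), ← ENNReal.rpow_mul]
  congr 2
  field_simp

lemma limsup_natCast_rpow_mul (hp : 0 < p) (μ : Measure (Fin d → ℝ)) :
    limsup (fun N : ℕ => (N : ℝ≥0∞) ^ ((d : ℝ)⁻¹) * expWpPow p μ N ^ (1 / p)) atTop
      = limCost p μ ^ (1 / p) := by
  simp_rw [natCast_rpow_mul_rpow hp]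
  exact ((ENNReal.orderIsoRpow (1 / p) (by positivity)).limsup_apply).symm

end final

end

/-- Upper bound of the high-resolution formula: for `d ≥ 3`, `1 ≤ p < d/2`, a
probability measure `μ` with finite `q`-th moment for some `q > dp/(d−p)` whose
absolutely continuous part has a Riemann integrable density `f`,
`limsup_N N^{1/d} E[ρ_p^p(μ, μ̂_N)]^{1/p} ≤ κ_p^unif (∫ f^{1−p/d})^{1/p}`,
where `κ_p^unif` is the limit constant for the uniform distribution on `[0,1)^d`. -/
theorem high_resolution_upper_bound {d : ℕ} (hd : 3 ≤ d) (p q : ℝ)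
    (hp : 1 ≤ p) (hpd : 2 * p < d) (hq : q > (d : ℝ) * p / ((d : ℝ) - p))
    (μ : Measure (Fin d → ℝ)) [IsProbabilityMeasure μ]
    (hmom : ∫⁻ x, (‖x‖₊ : ℝ≥0∞) ^ q ∂μ < ⊤)
    (f : (Fin d → ℝ) → ℝ) (hf0 : ∀ x, 0 ≤ f x) (hfR : RiemannIntegrableOnCubes f)
    (μs : Measure (Fin d → ℝ)) (hsing : μs ⟂ₘ (volume : Measure (Fin d → ℝ)))
    (hdecomp : μ = volume.withDensity (fun x => ENNReal.ofReal (f x)) + μs)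
    (κ : ℝ≥0∞) (hκ0 : 0 < κ) (hκfin : κ < ⊤)
    (hκ : Filter.Tendsto (fun N : ℕ => (N : ℝ≥0∞) ^ ((d : ℝ)⁻¹) *
        (expWpPow p (volume.restrict (unitBox d)) N) ^ (1 / p))
      Filter.atTop (nhds κ)) :
    Filter.limsup (fun N : ℕ => (N : ℝ≥0∞) ^ ((d : ℝ)⁻¹) *
        (expWpPow p μ N) ^ (1 / p)) Filter.atTop
      ≤ κ * (∫⁻ x, ENNReal.ofReal (f x ^ (1 - p / (d : ℝ)))) ^ (1 / p) := by
  have hp0 : 0 < p := by linarith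
  have hθ := one_sub_div_pos (by linarith : p < d) hp0
  rw [← hκ.limsup_eq, limsup_natCast_rpow_mul hp0, limsup_natCast_rpow_mul hp0,
    ← ENNReal.mul_rpow_of_nonneg _ _ (by positivity)]
  simp_rw [← ENNReal.ofReal_rpow_of_nonneg (hf0 _) hθ.le]
  gcongr
  exact limCost_le hp hpd hq hmom.ne hfR hsing hdecomp
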